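/- arXiv:1301.2445 — 3 statements merged into one kernel-verified Lean document; each statement's English description precedes it below -/
import Mathlib

section
/- Let v > 4 be an odd integer with prime factorization v = p₁^{n₁}···p_k^{n_k} such that p₁^{n₁} = 3 and every other prime p_i ≡ 1 (mod 3) for i > 1. Then the number of orbits of the affine group AGL₁(v) acting on B_con(v,3) — equivalently, the number of isomorphism classes of connected cyclic configurations of type (v_3) — equals (1/6)·v·∏_{i=1}^{k}(1 + 1/p_i) + (2/3)·2^k − 2. -/
open scoped Pointwise

/-- `B_con(v,3)`: base lines of connected cyclic configurations of type (v₃). -/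
def Bcon3 (v : ℕ) : Set (Finset (ZMod v)) :=
  {X | X.card = 3 ∧ (X - X).card = 7 ∧
    AddSubgroup.closure ((X - X : Finset (ZMod v)) : Set (ZMod v)) = ⊤}

/-- The orbit relation of the affine group `AGL₁(v)` acting on `B_con(v,3)` by
`X ↦ aX + b`. -/
def affRel3 (v : ℕ) (X Y : Bcon3 v) : Prop :=
  ∃ a : (ZMod v)ˣ, ∃ b : ZMod v,
    (Y : Finset (ZMod v)) = (X : Finset (ZMod v)).image (fun t => (a : ZMod v) * t + b)

/-- The number of orbits of `AGL₁(v)` on `B_con(v,3)`, i.e. the number of isomorphism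
classes of connected cyclic configurations of type (v₃). -/
noncomputable def numOrbits3 (v : ℕ) : ℕ :=
  Nat.card (Quot (affRel3 v))


namespace CyclicConf

section RingCounts

/-- The unimodular pairs of a commutative ring. -/
abbrev CoprimePairs (R : Type*) [CommRing R] : Type _ := {p : R × R // IsCoprime p.1 p.2}

/-- The square roots of unity of a commutative ring. -/
abbrev SqrtsOfOne (R : Type*) [CommRing R] : Type _ := {u : R // u ^ 2 = 1}

/-- The roots of `u² + u + 1` in a commutative ring. -/
abbrev CubicRoots (R : Type*) [CommRing R] : Type _ := {u : R // u ^ 2 + u + 1 = 0}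

variable {R S : Type*} [CommRing R] [CommRing S]

lemma isCoprime_prod_iff (a b : R × S) :
    IsCoprime a b ↔ IsCoprime a.1 b.1 ∧ IsCoprime a.2 b.2 := by
  constructor
  · rintro ⟨x, y, h⟩
    exact ⟨⟨x.1, y.1, congrArg Prod.fst h⟩, ⟨x.2, y.2, congrArg Prod.snd h⟩⟩
  · rintro ⟨⟨x, y, h⟩, ⟨z, w, h'⟩⟩
    exact ⟨(x, z), (y, w), Prod.ext h h'⟩

lemma card_coprimePairs_prod :
    Nat.card (CoprimePairs (R × S)) = Nat.card (CoprimePairs R) * Nat.card (CoprimePairs S) := by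
  rw [← Nat.card_prod]
  refine Nat.card_congr (((Equiv.prodProdProdComm R S R S).subtypeEquiv fun p => ?_).trans
    Equiv.subtypeProdEquivProd)
  exact isCoprime_prod_iff _ _

lemma card_sqrtsOfOne_prod :
    Nat.card (SqrtsOfOne (R × S)) = Nat.card (SqrtsOfOne R) * Nat.card (SqrtsOfOne S) := by
  rw [← Nat.card_prod]
  refine Nat.card_congr (((Equiv.refl (R × S)).subtypeEquiv fun p => ?_).trans
    Equiv.subtypeProdEquivProd)
  simp [Prod.ext_iff]

lemma card_cubicRoots_prod :
    Nat.card (CubicRoots (R × S)) = Nat.card (CubicRoots R) * Nat.card (CubicRoots S) := by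
  rw [← Nat.card_prod]
  refine Nat.card_congr (((Equiv.refl (R × S)).subtypeEquiv fun p => ?_).trans
    Equiv.subtypeProdEquivProd)
  simp [Prod.ext_iff]

lemma card_coprimePairs_congr (e : R ≃+* S) :
    Nat.card (CoprimePairs R) = Nat.card (CoprimePairs S) := by
  refine Nat.card_congr ((e.toEquiv.prodCongr e.toEquiv).subtypeEquiv fun p => ?_)
  refine ⟨fun h => h.map e.toRingHom, fun h => ?_⟩
  simpa using h.map e.symm.toRingHom

lemma card_sqrtsOfOne_congr (e : R ≃+* S) :
    Nat.card (SqrtsOfOne R) = Nat.card (SqrtsOfOne S) := by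
  refine Nat.card_congr (e.toEquiv.subtypeEquiv fun p => ?_)
  rw [← e.injective.eq_iff]
  simp

lemma card_cubicRoots_congr (e : R ≃+* S) :
    Nat.card (CubicRoots R) = Nat.card (CubicRoots S) := by
  refine Nat.card_congr (e.toEquiv.subtypeEquiv fun p => ?_)
  rw [← e.injective.eq_iff]
  simp

section IsLocalRing

variable [IsLocalRing R]

lemma card_coprimePairs_add [Finite R] :
    Nat.card (CoprimePairs R) + (Nat.card R - Nat.card Rˣ) ^ 2 = Nat.card R ^ 2 := by
  classical
  have := Fintype.ofFinite R
  have hunits : Nat.card Rˣ = Nat.card {a : R // IsUnit a} :=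
    Nat.card_congr (Equiv.ofInjective ((↑) : Rˣ → R) Units.val_injective)
  have hnon : Nat.card R - Nat.card Rˣ = Nat.card {a : R // ¬ IsUnit a} := by
    rw [hunits]
    simp only [Nat.card_eq_fintype_card]
    rw [Fintype.card_subtype_compl]
  have hpairs : Nat.card {p : R × R // ¬ IsCoprime p.1 p.2} =
      Nat.card {a : R // ¬ IsUnit a} ^ 2 := by
    rw [sq, ← Nat.card_prod]
    refine Nat.card_congr (((Equiv.refl (R × R)).subtypeEquiv fun p => ?_).trans
      Equiv.subtypeProdEquivProd)
    rw [← not_or, not_iff_not]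
    constructor
    · rintro ⟨x, y, h⟩
      rcases IsLocalRing.isUnit_or_isUnit_of_add_one h with h | h
      · exact Or.inl (isUnit_of_mul_isUnit_right h)
      · exact Or.inr (isUnit_of_mul_isUnit_right h)
    · rintro (h | h)
      · obtain ⟨x, hx⟩ := h.exists_left_inv
        exact ⟨x, 0, by simpa using hx⟩
      · obtain ⟨x, hx⟩ := h.exists_left_inv
        exact ⟨0, x, by simpa using hx⟩
  rw [hnon, ← hpairs, sq, ← Nat.card_prod]
  simp only [Nat.card_eq_fintype_card]
  rw [Fintype.card_subtype_compl]
  exact Nat.add_sub_cancel' (Fintype.card_subtype_le _)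

lemma mul_sub_eq_zero_iff {a b : R} (hab : IsUnit (a - b)) (u : R) :
    (u - a) * (u - b) = 0 ↔ u = a ∨ u = b := by
  constructor
  · intro h
    have key : IsUnit ((u - b) + -(u - a)) := by
      convert hab using 1
      ring
    rcases IsLocalRing.isUnit_or_isUnit_of_isUnit_add key with hu | hu
    · exact Or.inl (sub_eq_zero.1 (hu.mul_left_eq_zero.1 h))
    · exact Or.inr (sub_eq_zero.1 (((IsUnit.neg_iff _).1 hu).mul_right_eq_zero.1 h))
  · rintro (rfl | rfl) <;> simp

lemma card_quadratic_roots {a b : R} (hab : IsUnit (a - b)) {P : R → Prop}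
    (hP : ∀ u, P u ↔ (u - a) * (u - b) = 0) : Nat.card {u : R // P u} = 2 := by
  have hne : a ≠ b := by
    rintro rfl
    simp at hab
  rw [← Set.ncard_pair hne]
  refine Nat.card_congr (Equiv.subtypeEquivRight fun u => ?_)
  rw [hP, mul_sub_eq_zero_iff hab]
  simp

lemma card_sqrtsOfOne_of_isUnit_two (h2 : IsUnit (2 : R)) : Nat.card (SqrtsOfOne R) = 2 := by
  refine card_quadratic_roots (a := 1) (b := -1) (by convert h2 using 1; ring) fun u => ?_
  rw [← sub_eq_zero]
  ring_nf

lemma card_cubicRoots_of_isUnit_three (h3 : IsUnit (3 : R)) {w : R}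
    (hw : w ^ 2 + w + 1 = 0) : Nat.card (CubicRoots R) = 2 := by
  refine card_quadratic_roots (a := w) (b := -1 - w) ?_ fun u => ?_
  · refine isUnit_of_mul_isUnit_left (y := w - (-1 - w)) ?_
    convert h3.neg using 1
    linear_combination 4 * hw
  · rw [show (u - w) * (u - (-1 - w)) = u ^ 2 + u + 1 by linear_combination -hw]

lemma exists_cubicRoot [Finite R] (h3 : IsUnit (3 : R)) (hcard : 3 ∣ Nat.card Rˣ) :
    ∃ w : R, w ^ 2 + w + 1 = 0 := by
  obtain ⟨u, hu⟩ := exists_prime_orderOf_dvd_card' (hp := ⟨Nat.prime_three⟩) 3 hcard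
  have hu3 : (u : R) ^ 3 = 1 := by
    rw [← Units.val_pow_eq_pow_val, ← hu, pow_orderOf_eq_one, Units.val_one]
  have hprod : ((u : R) - 1) * ((u : R) ^ 2 + u + 1) = 0 := by linear_combination hu3
  have key : IsUnit (((u : R) ^ 2 + u + 1) + -(((u : R) + 2) * (u - 1))) := by
    convert h3 using 1
    ring
  refine ⟨u, ?_⟩
  rcases IsLocalRing.isUnit_or_isUnit_of_isUnit_add key with h | h
  · have h1 : (u : R) = 1 := sub_eq_zero.1 (h.mul_left_eq_zero.1 hprod)
    rw [Units.val_eq_one.1 h1, orderOf_one] at hu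
    omega
  · exact (isUnit_of_mul_isUnit_right ((IsUnit.neg_iff _).1 h)).mul_right_eq_zero.1 hprod

end IsLocalRing

end RingCounts

section ZModCounts

lemma isLocalRing_zmod_prime_pow {p k : ℕ} (hp : p.Prime) (hk : k ≠ 0) :
    IsLocalRing (ZMod (p ^ k)) := by
  have : Fact (1 < p ^ k) := ⟨Nat.one_lt_pow hk hp.one_lt⟩
  have hunit : ∀ a : ZMod (p ^ k), IsUnit a ↔ ¬ p ∣ a.val := fun a => by
    have : NeZero (p ^ k) := ⟨(pow_pos hp.pos k).ne'⟩
    rw [← ZMod.natCast_zmod_val a, ZMod.isUnit_iff_coprime, ZMod.natCast_zmod_val,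
      Nat.coprime_pow_right_iff (Nat.pos_of_ne_zero hk), Nat.coprime_comm,
      hp.coprime_iff_not_dvd]
  refine IsLocalRing.of_nonunits_add fun a b ha hb => ?_
  rw [mem_nonunits_iff, hunit, not_not] at ha hb ⊢
  rw [ZMod.val_add]
  exact (Nat.dvd_mod_iff (dvd_pow_self p hk)).2 (dvd_add ha hb)

lemma isUnit_natCast_zmod_prime_pow {p q k : ℕ} (hp : p.Prime) (hq : q.Prime) (h : p ≠ q) :
    IsUnit ((q : ℕ) : ZMod (p ^ k)) := by
  rw [ZMod.isUnit_prime_iff_not_dvd hq]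
  exact fun hd => h ((Nat.prime_dvd_prime_iff_eq hq hp).1 (hq.dvd_of_dvd_pow hd)).symm

lemma card_sqrtsOfOne_zmod {v : ℕ} (hv : Odd v) :
    Nat.card (SqrtsOfOne (ZMod v)) = 2 ^ v.primeFactors.card := by
  have h0 : v ≠ 0 := by rintro rfl; simp at hv
  rw [Nat.multiplicative_factorization (fun n => Nat.card (SqrtsOfOne (ZMod n)))
    (fun m n h => (card_sqrtsOfOne_congr (ZMod.chineseRemainder h)).trans card_sqrtsOfOne_prod)
    ?_ h0, Finsupp.prod, Nat.support_factorization, ← Finset.prod_const]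
  · refine Finset.prod_congr rfl fun p hp => ?_
    have hpp := Nat.prime_of_mem_primeFactors hp
    have := isLocalRing_zmod_prime_pow hpp (Finsupp.mem_support_iff.1
      (by rwa [Nat.support_factorization] : p ∈ v.factorization.support))
    refine card_sqrtsOfOne_of_isUnit_two ?_
    refine mod_cast isUnit_natCast_zmod_prime_pow hpp Nat.prime_two ?_
    rintro rfl
    exact (Nat.not_even_iff_odd.2 hv) (even_iff_two_dvd.2 (Nat.dvd_of_mem_primeFactors hp))
  · exact Nat.card_eq_one_iff_unique.2 ⟨inferInstance, ⟨⟨1, one_pow 2⟩⟩⟩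

lemma card_cubicRoots_zmod {v : ℕ} (h3 : 3 ∣ v) (h9 : ¬ 9 ∣ v)
    (hp : ∀ p ∈ v.primeFactors, p ≠ 3 → p % 3 = 1) :
    2 * Nat.card (CubicRoots (ZMod v)) = 2 ^ v.primeFactors.card := by
  have h0 : v ≠ 0 := by rintro rfl; simp at h9
  have h3mem : 3 ∈ v.primeFactors := Nat.mem_primeFactors.2 ⟨Nat.prime_three, h3, h0⟩
  rw [Nat.multiplicative_factorization (fun n => Nat.card (CubicRoots (ZMod n)))
    (fun m n h => (card_cubicRoots_congr (ZMod.chineseRemainder h)).trans card_cubicRoots_prod)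
    ?_ h0, Finsupp.prod, Nat.support_factorization, ← Finset.prod_const,
    ← Finset.mul_prod_erase _ _ h3mem, ← Finset.mul_prod_erase _ (fun _ => 2) h3mem]
  · have hfac : v.factorization 3 = 1 := by
      have h1 : 1 ≤ v.factorization 3 :=
        (Nat.prime_three.pow_dvd_iff_le_factorization h0).1 (by simpa using h3)
      have h2 : ¬ 2 ≤ v.factorization 3 := fun h =>
        h9 (by simpa using (Nat.prime_three.pow_dvd_iff_le_factorization h0).2 h)
      omega
    have hthree : Nat.card (CubicRoots (ZMod (3 ^ 1))) = 1 := by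
      rw [pow_one, Nat.card_eq_fintype_card]
      decide
    rw [hfac, hthree, one_mul]
    congr 1
    refine Finset.prod_congr rfl fun p hp' => ?_
    obtain ⟨hp3, hpv⟩ := Finset.mem_erase.1 hp'
    have hpp := Nat.prime_of_mem_primeFactors hpv
    have hk : v.factorization p ≠ 0 := Finsupp.mem_support_iff.1
      (by rwa [Nat.support_factorization] : p ∈ v.factorization.support)
    have := isLocalRing_zmod_prime_pow hpp hk
    have : NeZero (p ^ v.factorization p) := ⟨(pow_pos hpp.pos _).ne'⟩
    have hu3 : IsUnit (3 : ZMod (p ^ v.factorization p)) :=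
      mod_cast isUnit_natCast_zmod_prime_pow hpp Nat.prime_three hp3
    obtain ⟨w, hw⟩ := exists_cubicRoot hu3 (by
      rw [Nat.card_eq_fintype_card, ZMod.card_units_eq_totient,
        Nat.totient_prime_pow hpp (Nat.pos_of_ne_zero hk)]
      have := hp p hpv hp3
      exact Dvd.dvd.mul_left (by omega) _)
    exact card_cubicRoots_of_isUnit_three hu3 hw
  · exact Nat.card_eq_one_iff_unique.2 ⟨inferInstance, ⟨⟨1, Subsingleton.elim _ _⟩⟩⟩

lemma card_coprimePairs_zmod {v : ℕ} (h0 : v ≠ 0) :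
    (Nat.card (CoprimePairs (ZMod v)) : ℚ) =
      v.totient * (v * ∏ p ∈ v.primeFactors, (1 + 1 / (p : ℚ))) := by
  rw [Nat.multiplicative_factorization (fun n => Nat.card (CoprimePairs (ZMod n)))
    (fun m n h => (card_coprimePairs_congr (ZMod.chineseRemainder h)).trans
      card_coprimePairs_prod) ?_ h0,
    Nat.multiplicative_factorization Nat.totient (fun m n => Nat.totient_mul) Nat.totient_one h0]
  · have hprod : (v : ℚ) = ∏ p ∈ v.primeFactors, (p : ℚ) ^ v.factorization p := by
      conv_lhs => rw [← Nat.prod_factorization_pow_eq_self h0]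
      simp [Finsupp.prod]
    conv_rhs => rw [hprod]
    simp only [Finsupp.prod, Nat.support_factorization]
    push_cast
    rw [← Finset.prod_mul_distrib, ← Finset.prod_mul_distrib]
    refine Finset.prod_congr rfl fun p hp => ?_
    have hpp := Nat.prime_of_mem_primeFactors hp
    have hk : v.factorization p ≠ 0 := Finsupp.mem_support_iff.1
      (by rwa [Nat.support_factorization] : p ∈ v.factorization.support)
    have := isLocalRing_zmod_prime_pow hpp hk
    have : NeZero (p ^ v.factorization p) := ⟨(pow_pos hpp.pos _).ne'⟩
    have h := card_coprimePairs_add (R := ZMod (p ^ v.factorization p))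
    rw [Nat.card_zmod, Nat.card_eq_fintype_card (α := (ZMod (p ^ v.factorization p))ˣ),
      ZMod.card_units_eq_totient] at h
    have h' := congrArg (Nat.cast : ℕ → ℚ) h
    rw [Nat.cast_add, Nat.cast_pow, Nat.cast_sub (Nat.totient_le _)] at h'
    obtain ⟨k, hk'⟩ := Nat.exists_eq_succ_of_ne_zero hk
    have hp0 : (p : ℚ) ≠ 0 := Nat.cast_ne_zero.2 hpp.ne_zero
    rw [hk'] at h' ⊢
    rw [Nat.totient_prime_pow_succ hpp] at h' ⊢
    have hcast : ((p - 1 : ℕ) : ℚ) = p - 1 := Nat.cast_pred hpp.pos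
    push_cast [hcast] at h' ⊢
    rw [← eq_sub_iff_add_eq] at h'
    rw [h']
    simp only [Nat.succ_eq_add_one, pow_succ]
    field_simp
    ring
  · exact Nat.card_eq_one_iff_unique.2 ⟨inferInstance, ⟨⟨1, isCoprime_one_left⟩⟩⟩

end ZModCounts
section PrimTriple

open Equiv MulAction

/-- The unimodular triples with sum zero over a commutative ring. -/
structure PrimTriple (R : Type*) [CommRing R] where
  /-- The entries of the triple. -/
  val : Fin 3 → R
  sum_val : ∑ i, val i = 0
  exists_sum_mul : ∃ c : Fin 3 → R, ∑ i, c i * val i = 1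

variable {R : Type*} [CommRing R]

namespace PrimTriple

@[ext]
lemma ext {d e : PrimTriple R} (h : ∀ i, d.1 i = e.1 i) : d = e := by
  cases d
  cases e
  congr
  exact funext h

instance [Finite R] : Finite (PrimTriple R) :=
  Finite.of_injective val fun _ _ h => ext (congrFun h)

/-- Units act on triples by scaling, permutations by permuting the entries. -/
instance : MulAction (Rˣ × Perm (Fin 3)) (PrimTriple R) where
  smul g d := ⟨fun i => g.1 * d.1 (g.2⁻¹ i), by
    rw [← Finset.mul_sum, Equiv.sum_comp g.2⁻¹ d.1, d.sum_val, mul_zero], by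
    obtain ⟨c, hc⟩ := d.exists_sum_mul
    refine ⟨fun i => ↑g.1⁻¹ * c (g.2⁻¹ i), ?_⟩
    rw [← hc, ← Equiv.sum_comp g.2⁻¹ fun i => c i * d.1 i]
    refine Finset.sum_congr rfl fun i _ => ?_
    linear_combination c (g.2⁻¹ i) * d.1 (g.2⁻¹ i) * g.1.inv_mul⟩
  one_smul _ := ext fun i => one_mul _
  mul_smul g h d := ext fun i => by
    change ((g.1 * h.1 : Rˣ) : R) * d.1 ((g.2 * h.2)⁻¹ i) = g.1 * (h.1 * d.1 (h.2⁻¹ (g.2⁻¹ i)))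
    rw [Units.val_mul, mul_assoc, mul_inv_rev, Perm.mul_apply]

lemma smul_apply (g : Rˣ × Perm (Fin 3)) (d : PrimTriple R) (i : Fin 3) :
    (g • d).1 i = g.1 * d.1 (g.2⁻¹ i) := rfl

lemma eq_one_of_forall_mul_eq (d : PrimTriple R) {u : R} (h : ∀ i, u * d.1 i = d.1 i) :
    u = 1 := by
  obtain ⟨c, hc⟩ := d.exists_sum_mul
  rw [← mul_one u, ← hc, Finset.mul_sum]
  refine Finset.sum_congr rfl fun i _ => ?_
  linear_combination c i * h i

/-- The triple determined by its first two entries, which have to be coprime. -/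
def ofPair (a b : R) (h : IsCoprime a b) : PrimTriple R :=
  ⟨![a, b, -(a + b)], by rw [Fin.sum_univ_three]; simp, by
    obtain ⟨x, y, h⟩ := h
    exact ⟨![x, y, 0], by rw [Fin.sum_univ_three]; simpa using h⟩⟩

lemma two_eq (d : PrimTriple R) : d.1 2 = -(d.1 0 + d.1 1) := by
  have h := d.sum_val
  rw [Fin.sum_univ_three] at h
  linear_combination h

lemma ext_pair {d e : PrimTriple R} (h0 : d.1 0 = e.1 0) (h1 : d.1 1 = e.1 1) : d = e := by
  ext i
  fin_cases i
  · exact h0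
  · exact h1
  · change d.1 2 = e.1 2
    rw [two_eq, two_eq, h0, h1]

lemma isCoprime (d : PrimTriple R) : IsCoprime (d.1 0) (d.1 1) := by
  obtain ⟨c, hc⟩ := d.exists_sum_mul
  rw [Fin.sum_univ_three, two_eq] at hc
  exact ⟨c 0 - c 2, c 1 - c 2, by linear_combination hc⟩

lemma isUnit_zero_of_one_eq (d : PrimTriple R) {u : R} (h : d.1 1 = u * d.1 0) :
    IsUnit (d.1 0) :=
  d.isCoprime.isUnit_of_dvd ⟨u, by rw [h, mul_comm]⟩

/-- A sum-zero unimodular triple is the same as a unimodular pair. -/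
def equivCoprimePairs : PrimTriple R ≃ CoprimePairs R where
  toFun d := ⟨(d.1 0, d.1 1), d.isCoprime⟩
  invFun p := ofPair p.1.1 p.1.2 p.2
  left_inv _ := ext_pair rfl rfl
  right_inv _ := rfl

/-- The pairs of a unit `u` and a triple fixed by `(u, σ)`. -/
abbrev FixedPairs (R : Type*) [CommRing R] (σ : Perm (Fin 3)) : Type _ :=
  {q : Rˣ × PrimTriple R // (q.1, σ) • q.2 = q.2}

lemma card_fixedPairs_one : Nat.card (FixedPairs R 1) = Nat.card (CoprimePairs R) := by
  rw [← Nat.card_congr equivCoprimePairs]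
  refine Nat.card_congr (Equiv.ofBijective (fun q => q.1.2) ⟨?_, fun d => ⟨⟨(1, d), ?_⟩, rfl⟩⟩)
  · have key : ∀ q : FixedPairs R 1, q.1.1 = 1 := fun q => Units.ext <|
      q.1.2.eq_one_of_forall_mul_eq fun i => congrFun (congrArg val q.2) i
    exact fun q r h => Subtype.ext (Prod.ext ((key q).trans (key r).symm) h)
  · exact one_smul (Rˣ × Perm (Fin 3)) d

lemma card_fixedPairs_conj (σ τ : Perm (Fin 3)) :
    Nat.card (FixedPairs R (τ * σ * τ⁻¹)) = Nat.card (FixedPairs R σ) := by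
  symm
  refine Nat.card_congr (((Equiv.refl Rˣ).prodCongr
    (MulAction.toPerm ((1, τ) : Rˣ × Perm (Fin 3)))).subtypeEquiv fun q => ?_)
  change _ ↔ (q.1, τ * σ * τ⁻¹) • ((1, τ) : Rˣ × Perm (Fin 3)) • q.2 =
    ((1, τ) : Rˣ × Perm (Fin 3)) • q.2
  rw [smul_smul, ← (MulAction.injective ((1, τ) : Rˣ × Perm (Fin 3))).eq_iff, smul_smul]
  simp

lemma smul_swap_eq_iff (u : Rˣ) (d : PrimTriple R) :
    (u, (swap 0 1 : Perm (Fin 3))) • d = d ↔ (u : R) ^ 2 = 1 ∧ d.1 1 = u * d.1 0 ∧ IsUnit (d.1 0) := by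
  have hs : ((swap 0 1 : Perm (Fin 3))⁻¹ 0 = 1) ∧ ((swap 0 1 : Perm (Fin 3))⁻¹ 1 = 0) ∧
    ((swap 0 1 : Perm (Fin 3))⁻¹ 2 = 2) := by decide
  constructor
  · intro h
    have h' := fun i => congrFun (congrArg val h) i
    have h0 := h' 0
    have h1 := h' 1
    simp only [smul_apply, hs] at h0 h1
    refine ⟨d.eq_one_of_forall_mul_eq fun i => ?_, h1.symm, d.isUnit_zero_of_one_eq h1.symm⟩
    fin_cases i
    · change (u : R) ^ 2 * d.1 0 = d.1 0
      linear_combination (u : R) * h1 + h0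
    · change (u : R) ^ 2 * d.1 1 = d.1 1
      linear_combination (u : R) * h0 + h1
    · change (u : R) ^ 2 * d.1 2 = d.1 2
      rw [two_eq]
      linear_combination -((u : R) + 1) * (h0 + h1)
  · rintro ⟨hu, hd, -⟩
    refine ext_pair ?_ ?_ <;> simp only [smul_apply, hs]
    · linear_combination (u : R) * hd + d.1 0 * hu
    · exact hd.symm

lemma smul_finRotate_eq_iff (u : Rˣ) (d : PrimTriple R) :
    (u, finRotate 3) • d = d ↔
      (u : R) ^ 2 + u + 1 = 0 ∧ d.1 1 = u * d.1 0 ∧ IsUnit (d.1 0) := by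
  have hs : ((finRotate 3)⁻¹ 0 = 2) ∧ ((finRotate 3)⁻¹ 1 = 0) ∧ ((finRotate 3)⁻¹ 2 = 1) := by
    decide
  constructor
  · intro h
    have h' := fun i => congrFun (congrArg val h) i
    have h1 := h' 1
    have h2 := h' 2
    simp only [smul_apply, hs] at h1 h2
    rw [two_eq] at h2
    have hunit := d.isUnit_zero_of_one_eq h1.symm
    refine ⟨hunit.mul_left_eq_zero.1 ?_, h1.symm, hunit⟩
    linear_combination ((u : R) + 1) * h1 + h2
  · rintro ⟨hu, hd, -⟩
    refine ext_pair ?_ ?_ <;> simp only [smul_apply, hs]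
    · rw [two_eq]
      linear_combination -(u : R) * hd - d.1 0 * hu
    · exact hd.symm

lemma card_fixedPairs_of_iff {σ : Perm (Fin 3)} {P : R → Prop} (hP : ∀ u, P u → IsUnit u)
    (h : ∀ (u : Rˣ) (d : PrimTriple R), (u, σ) • d = d ↔
      P u ∧ d.1 1 = u * d.1 0 ∧ IsUnit (d.1 0)) :
    Nat.card (FixedPairs R σ) = Nat.card {u : R // P u} * Nat.card Rˣ := by
  rw [← Nat.card_prod]
  refine Nat.card_congr (Equiv.ofBijective (fun q => (⟨q.1.1, ((h _ _).1 q.2).1⟩,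
    ((h _ _).1 q.2).2.2.unit)) ⟨?_, ?_⟩)
  · rintro ⟨⟨u, d⟩, hq⟩ ⟨⟨w, e⟩, hr⟩ hqr
    have huw : u = w := Units.ext (congrArg (fun t => t.1.1) hqr)
    have hde : d.1 0 = e.1 0 := congrArg (fun t => (t.2 : R)) hqr
    refine Subtype.ext (Prod.ext huw (ext_pair hde ?_))
    rw [((h _ _).1 hq).2.1, ((h _ _).1 hr).2.1, hde, huw]
  · rintro ⟨⟨u, hu⟩, a⟩
    obtain ⟨u, rfl⟩ := hP u hu
    refine ⟨⟨(u, ofPair a (u * a) ⟨↑a⁻¹, 0, by simp⟩), (h _ _).2 ⟨hu, rfl, a.isUnit⟩⟩, ?_⟩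
    exact Prod.ext rfl (Units.ext rfl)

lemma card_fixedPairs_of_sign_eq_neg_one {σ : Perm (Fin 3)} (hσ : Perm.sign σ = -1) :
    Nat.card (FixedPairs R σ) = Nat.card (SqrtsOfOne R) * Nat.card Rˣ := by
  have key : ∀ σ : Perm (Fin 3), Perm.sign σ = -1 → ∃ τ, σ = τ * swap 0 1 * τ⁻¹ := by decide
  obtain ⟨τ, rfl⟩ := key σ hσ
  rw [card_fixedPairs_conj]
  exact card_fixedPairs_of_iff (fun u hu => IsUnit.of_mul_eq_one u (by rwa [← sq]))
    smul_swap_eq_iff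

lemma card_fixedPairs_of_sign_eq_one {σ : Perm (Fin 3)} (hσ : Perm.sign σ = 1) (h1 : σ ≠ 1) :
    Nat.card (FixedPairs R σ) = Nat.card (CubicRoots R) * Nat.card Rˣ := by
  have key : ∀ σ : Perm (Fin 3), Perm.sign σ = 1 → σ ≠ 1 → ∃ τ, σ = τ * finRotate 3 * τ⁻¹ := by
    decide
  obtain ⟨τ, rfl⟩ := key σ hσ h1
  rw [card_fixedPairs_conj]
  exact card_fixedPairs_of_iff
    (fun u hu => IsUnit.of_mul_eq_one (-(u + 1)) (by linear_combination -hu))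
    smul_finRotate_eq_iff

/-- The orbits of scalings and permutations on the unimodular sum-zero triples. -/
abbrev Orbits (R : Type*) [CommRing R] : Type _ :=
  Quotient (orbitRel (Rˣ × Perm (Fin 3)) (PrimTriple R))

lemma card_orbits [Finite R] :
    Nat.card (Orbits R) * (6 * Nat.card Rˣ) = Nat.card (CoprimePairs R) +
      3 * (Nat.card (SqrtsOfOne R) * Nat.card Rˣ) +
      2 * (Nat.card (CubicRoots R) * Nat.card Rˣ) := by
  classical
  have := Fintype.ofFinite R
  have := Fintype.ofFinite (PrimTriple R)
  have burnside := sum_card_fixedBy_eq_card_orbits_mul_card_group (Rˣ × Perm (Fin 3))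
    (PrimTriple R)
  have hfix : ∀ σ : Perm (Fin 3), ∑ u : Rˣ, Fintype.card (fixedBy (PrimTriple R) (u, σ)) =
      Nat.card (FixedPairs R σ) := fun σ => by
    rw [← Fintype.card_sigma, ← Nat.card_eq_fintype_card]
    exact Nat.card_congr (Equiv.subtypeProdEquivSigmaSubtype
      fun (u : Rˣ) (d : PrimTriple R) => (u, σ) • d = d).symm
  have hval : ∀ σ : Perm (Fin 3), Nat.card (FixedPairs R σ) =
      if σ = 1 then Nat.card (CoprimePairs R) else if Perm.sign σ = -1 then
        Nat.card (SqrtsOfOne R) * Nat.card Rˣ else Nat.card (CubicRoots R) * Nat.card Rˣ := by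
    intro σ
    split_ifs with h1 hs
    · rw [h1, card_fixedPairs_one]
    · exact card_fixedPairs_of_sign_eq_neg_one hs
    · exact card_fixedPairs_of_sign_eq_one ((Int.units_eq_one_or _).resolve_right hs) h1
  rw [Fintype.sum_prod_type_right] at burnside
  simp only [hfix, hval, Finset.sum_ite, Finset.sum_const, Finset.filter_filter,
    smul_eq_mul] at burnside
  rw [show (Finset.univ.filter fun σ : Perm (Fin 3) => σ = 1).card = 1 by decide,
    show (Finset.univ.filter fun σ : Perm (Fin 3) => ¬σ = 1 ∧ Perm.sign σ = -1).card = 3 by decide,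
    show (Finset.univ.filter fun σ : Perm (Fin 3) => ¬σ = 1 ∧ ¬Perm.sign σ = -1).card = 2
      by decide, Fintype.card_prod, Fintype.card_perm, Fintype.card_fin] at burnside
  simp only [Nat.card_eq_fintype_card] at burnside ⊢
  rw [show Nat.factorial 3 = 6 from rfl] at burnside
  linarith

end PrimTriple

end PrimTriple
section Differences

open Equiv MulAction

variable {R : Type*} [CommRing R]

/-- The cyclic differences of a triple. -/
def delta (x : Fin 3 → R) (i : Fin 3) : R := x (i + 1) - x (i + 2)

lemma sum_delta (x : Fin 3 → R) : ∑ i, delta x i = 0 := by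
  rw [Fin.sum_univ_three]
  change (x 1 - x 2) + (x 2 - x 0) + (x 0 - x 1) = 0
  ring

lemma delta_affine (x : Fin 3 → R) (a b : R) (i : Fin 3) :
    delta (fun j => a * x j + b) i = a * delta x i := by
  simp only [delta]
  ring

lemma delta_comp_perm (x : Fin 3 → R) (σ : Perm (Fin 3)) (i : Fin 3) :
    delta (x ∘ σ) i = ((Perm.sign σ : ℤˣ) : ℤ) * delta x (σ i) := by
  have key : ∀ (σ : Perm (Fin 3)) (i : Fin 3),
      (Perm.sign σ = 1 ∧ σ (i + 1) = σ i + 1 ∧ σ (i + 2) = σ i + 2) ∨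
      (Perm.sign σ = -1 ∧ σ (i + 1) = σ i + 2 ∧ σ (i + 2) = σ i + 1) := by decide
  rcases key σ i with ⟨h, h1, h2⟩ | ⟨h, h1, h2⟩ <;>
    simp [delta, h, h1, h2]

lemma eq_add_of_delta_eq {x y : Fin 3 → R} (h : ∀ i, delta x i = delta y i) (i : Fin 3) :
    y i = x i + (y 0 - x 0) := by
  have h1 : x 2 - x 0 = y 2 - y 0 := h 1
  have h2 : x 0 - x 1 = y 0 - y 1 := h 2
  fin_cases i
  · change y 0 = x 0 + (y 0 - x 0)
    ring
  · change y 1 = x 1 + (y 0 - x 0)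
    linear_combination h2
  · change y 2 = x 2 + (y 0 - x 0)
    linear_combination -h1

lemma injective_iff_delta_ne_zero (x : Fin 3 → R) :
    Function.Injective x ↔ ∀ i, delta x i ≠ 0 := by
  constructor
  · intro h i h0
    exact absurd (h (sub_eq_zero.1 h0)) ((by decide : ∀ i : Fin 3, i + 1 ≠ i + 2) i)
  · intro h i j hij
    by_contra hne
    have key : ∀ i j : Fin 3, i ≠ j → ∃ k, (k + 1 = i ∧ k + 2 = j) ∨ (k + 1 = j ∧ k + 2 = i) := by
      decide
    obtain ⟨k, ⟨rfl, rfl⟩ | ⟨rfl, rfl⟩⟩ := key i j hne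
    · exact h k (sub_eq_zero.2 hij)
    · exact h k (sub_eq_zero.2 hij.symm)

/-- A triple with the given sum-zero differences. -/
def antiDelta (d : Fin 3 → R) : Fin 3 → R := ![0, -d 2, d 1]

lemma delta_antiDelta {d : Fin 3 → R} (hd : ∑ i, d i = 0) : delta (antiDelta d) = d := by
  rw [Fin.sum_univ_three] at hd
  funext i
  fin_cases i
  · change -d 2 - d 1 = d 0
    linear_combination -hd
  · change d 1 - 0 = d 1
    ring
  · change 0 - -d 2 = d 2
    ring

section Finset

variable [DecidableEq R]

lemma image_sub_image_eq (x : Fin 3 → R) :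
    (Finset.univ.image x - Finset.univ.image x : Finset R) =
      [0, delta x 0, -delta x 0, delta x 1, -delta x 1, delta x 2, -delta x 2].toFinset := by
  have h0 : delta x 0 = x 1 - x 2 := rfl
  have h1 : delta x 1 = x 2 - x 0 := rfl
  have h2 : delta x 2 = x 0 - x 1 := rfl
  ext z
  simp only [Finset.mem_sub, Finset.mem_image, Finset.mem_univ, true_and, List.mem_toFinset,
    List.mem_cons, List.not_mem_nil, or_false, h0, h1, h2]
  constructor
  · rintro ⟨_, ⟨i, rfl⟩, _, ⟨j, rfl⟩, rfl⟩
    fin_cases i <;> fin_cases j <;> simp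
  · rintro (rfl | rfl | rfl | rfl | rfl | rfl | rfl)
    · exact ⟨_, ⟨0, rfl⟩, _, ⟨0, rfl⟩, sub_self _⟩
    · exact ⟨_, ⟨1, rfl⟩, _, ⟨2, rfl⟩, rfl⟩
    · exact ⟨_, ⟨2, rfl⟩, _, ⟨1, rfl⟩, (neg_sub _ _).symm⟩
    · exact ⟨_, ⟨2, rfl⟩, _, ⟨0, rfl⟩, rfl⟩
    · exact ⟨_, ⟨0, rfl⟩, _, ⟨2, rfl⟩, (neg_sub _ _).symm⟩
    · exact ⟨_, ⟨0, rfl⟩, _, ⟨1, rfl⟩, rfl⟩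
    · exact ⟨_, ⟨1, rfl⟩, _, ⟨0, rfl⟩, (neg_sub _ _).symm⟩

lemma injective_fin_three_iff {α : Type*} (f : Fin 3 → α) :
    Function.Injective f ↔ f 0 ≠ f 1 ∧ f 0 ≠ f 2 ∧ f 1 ≠ f 2 := by
  constructor
  · intro h
    exact ⟨h.ne (by decide), h.ne (by decide), h.ne (by decide)⟩
  · rintro ⟨h01, h02, h12⟩ i j hij
    fin_cases i <;> fin_cases j <;> simp_all

lemma card_image_sub_image_eq_seven_iff (h2 : IsUnit (2 : R)) (x : Fin 3 → R) :
    (Finset.univ.image x - Finset.univ.image x : Finset R).card = 7 ↔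
      Function.Injective (delta x) ∧ ∀ i, delta x i ≠ 0 := by
  have hsum := sum_delta x
  rw [Fin.sum_univ_three] at hsum
  have hneg : ∀ a : R, a = -a ↔ a = 0 := fun a => by
    rw [eq_neg_iff_add_eq_zero, ← two_mul, h2.mul_right_eq_zero]
  have h01 : delta x 0 = -delta x 1 ↔ delta x 2 = 0 :=
    ⟨fun h => by linear_combination hsum - h, fun h => by linear_combination hsum - h⟩
  have h02 : delta x 0 = -delta x 2 ↔ delta x 1 = 0 :=
    ⟨fun h => by linear_combination hsum - h, fun h => by linear_combination hsum - h⟩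
  have h12 : delta x 1 = -delta x 2 ↔ delta x 0 = 0 :=
    ⟨fun h => by linear_combination hsum - h, fun h => by linear_combination hsum - h⟩
  have hnodup : (Finset.univ.image x - Finset.univ.image x : Finset R).card = 7 ↔
      [0, delta x 0, -delta x 0, delta x 1, -delta x 1, delta x 2, -delta x 2].Nodup := by
    rw [image_sub_image_eq, ← Multiset.coe_nodup, ← Multiset.toFinset_card_eq_card_iff_nodup]
    rfl
  have hforall : (∀ i, delta x i ≠ 0) ↔ delta x 0 ≠ 0 ∧ delta x 1 ≠ 0 ∧ delta x 2 ≠ 0 := by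
    simp [Fin.forall_fin_succ]
  rw [hnodup, injective_fin_three_iff, hforall]
  generalize delta x 0 = a at *
  generalize delta x 1 = b at *
  generalize delta x 2 = c at *
  simp only [List.nodup_cons, List.mem_cons, List.not_mem_nil, not_or, List.nodup_nil,
    hneg, h01, h02, h12, neg_eq_iff_eq_neg, neg_neg, neg_zero, eq_comm (a := (0 : R)),
    ne_eq, not_false_eq_true, and_true]
  constructor <;> intro h <;> simp only [h, not_false_eq_true, and_self]

/-- Triples of distinct elements have affinely equivalent images iff their differences agree up
to units and permutations. -/
lemma image_affine_iff {x y : Fin 3 → R} (hx : Function.Injective x)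
    (hy : Function.Injective y) :
    (∃ (a : Rˣ) (b : R), Finset.univ.image y =
      (Finset.univ.image x).image fun t => (a : R) * t + b) ↔
    ∃ g : Rˣ × Perm (Fin 3), ∀ i, delta y i = g.1 * delta x (g.2⁻¹ i) := by
  constructor
  · rintro ⟨a, b, h⟩
    set z : Fin 3 → R := fun j => a * x j + b with hz
    have hzinj : Function.Injective z := fun i j hij =>
      hx (a.mul_right_inj.1 (add_right_cancel hij))
    rw [Finset.image_image] at h
    have hrange : ∀ i, y i ∈ Finset.univ.image z := fun i => by
      change y i ∈ Finset.univ.image ((fun t => (a : R) * t + b) ∘ x)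
      rw [← h]
      exact Finset.mem_image_of_mem y (Finset.mem_univ i)
    choose σ hσ using fun i => Finset.mem_image.1 (hrange i)
    have hσinj : Function.Injective σ := fun i j hij => hy <| by
      rw [← (hσ i).2, ← (hσ j).2, hij]
    obtain ⟨σ, rfl⟩ : ∃ τ : Perm (Fin 3), ⇑τ = σ :=
      ⟨Equiv.ofBijective σ (Finite.injective_iff_bijective.1 hσinj), rfl⟩
    have hy' : y = z ∘ σ := funext fun i => (hσ i).2.symm
    refine ⟨(Units.map (Int.castRingHom R).toMonoidHom (Perm.sign σ) * a, σ⁻¹), fun i => ?_⟩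
    rw [hy', delta_comp_perm, hz, delta_affine]
    simp [mul_assoc]
  · rintro ⟨⟨u, σ⟩, h⟩
    have hs : (((Perm.sign σ : ℤˣ) : ℤ) : R) * ((Perm.sign σ : ℤˣ) : ℤ) = 1 := by
      rw [← Int.cast_mul, ← Units.val_mul, Int.units_mul_self]
      simp
    set a : Rˣ := Units.map (Int.castRingHom R).toMonoidHom (Perm.sign σ) * u with ha
    have hdelta : ∀ i, delta ((fun j => (a : R) * x j + 0) ∘ ⇑σ⁻¹) i = delta y i := fun i => by
      rw [delta_comp_perm, delta_affine, h, Perm.sign_inv]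
      change _ * ((((Perm.sign σ : ℤˣ) : ℤ) : R) * u * _) = _
      linear_combination u * delta x (σ⁻¹ i) * hs
    refine ⟨a, y 0 - ((fun j => (a : R) * x j + 0) ∘ ⇑σ⁻¹) 0, ?_⟩
    rw [Finset.image_image]
    set b := y 0 - ((fun j => (a : R) * x j + 0) ∘ ⇑σ⁻¹) 0 with hb
    have hy' : y = ((fun t => (a : R) * t + b) ∘ x) ∘ ⇑σ⁻¹ := by
      funext i
      rw [eq_add_of_delta_eq hdelta i, ← hb]
      simp
    rw [hy', ← Finset.image_image]
    congr 1
    exact Finset.image_univ_equiv σ⁻¹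

end Finset

lemma closure_image_sub_image_eq_top_iff {v : ℕ} (x : Fin 3 → ZMod v) :
    AddSubgroup.closure ((Finset.univ.image x - Finset.univ.image x : Finset (ZMod v)) :
      Set (ZMod v)) = ⊤ ↔ ∃ c : Fin 3 → ZMod v, ∑ i, c i * delta x i = 1 := by
  rw [← Ideal.mem_span_range_iff_exists_fun, ← Ideal.eq_top_iff_one]
  set D : Set (ZMod v) :=
    ((Finset.univ.image x - Finset.univ.image x : Finset (ZMod v)) : Set (ZMod v)) with hD
  have hmem : ∀ i, delta x i ∈ D := fun i =>
    Finset.mem_coe.2 (Finset.sub_mem_sub (Finset.mem_image_of_mem x (Finset.mem_univ _))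
      (Finset.mem_image_of_mem x (Finset.mem_univ _)))
  constructor
  · intro h
    rw [Ideal.eq_top_iff_one]
    have hle : AddSubgroup.closure D ≤ (Ideal.span (Set.range (delta x))).toAddSubgroup := by
      rw [AddSubgroup.closure_le]
      intro z hz
      have hd : ∀ i, delta x i ∈ Ideal.span (Set.range (delta x)) := fun i =>
        Ideal.subset_span ⟨i, rfl⟩
      rw [hD, Finset.mem_coe, image_sub_image_eq] at hz
      simp only [List.mem_toFinset, List.mem_cons, List.not_mem_nil, or_false] at hz
      rcases hz with h | h | h | h | h | h | h <;> rw [h]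
      · exact zero_mem _
      all_goals first | exact hd _ | exact neg_mem (hd _)
    exact hle (h ▸ AddSubgroup.mem_top _)
  · intro h
    have hle : Ideal.span (Set.range (delta x)) ≤
        (AddSubgroup.toZModSubmodule v (AddSubgroup.closure D) : Submodule (ZMod v) (ZMod v)) := by
      refine Ideal.span_le.2 ?_
      rintro _ ⟨i, rfl⟩
      exact AddSubgroup.subset_closure (hmem i)
    rw [h] at hle
    exact top_unique fun z _ => hle (Submodule.mem_top (x := z))

end Differences

namespace PrimTriple

section Degenerate

open Equiv MulAction

variable {R : Type*} [CommRing R]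

/-- The triples whose entries are distinct and nonzero. -/
def Nondegenerate (d : PrimTriple R) : Prop := Function.Injective d.1 ∧ ∀ i, d.1 i ≠ 0

lemma nondegenerate_smul_iff (g : Rˣ × Perm (Fin 3)) (d : PrimTriple R) :
    (g • d).Nondegenerate ↔ d.Nondegenerate := by
  have key : ∀ (g : Rˣ × Perm (Fin 3)) (d : PrimTriple R),
      d.Nondegenerate → (g • d).Nondegenerate := fun g d h =>
    ⟨fun i j hij => g.2⁻¹.injective (h.1 (g.1.mul_right_inj.1 hij)),
      fun i h0 => h.2 _ (g.1.mul_right_eq_zero.1 h0)⟩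
  refine ⟨fun h => ?_, key g d⟩
  simpa using key g⁻¹ _ h

/-- The triple `(1, -1, 0)`. -/
def zeroTriple (R : Type*) [CommRing R] : PrimTriple R := ofPair 1 (-1) isCoprime_one_left

/-- The triple `(1, 1, -2)`. -/
def doubleTriple (R : Type*) [CommRing R] : PrimTriple R := ofPair 1 1 isCoprime_one_left

lemma nondegenerate_iff (d : PrimTriple R) :
    d.Nondegenerate ↔ (⟦d⟧ : Orbits R) ≠ ⟦zeroTriple R⟧ ∧
      (⟦d⟧ : Orbits R) ≠ ⟦doubleTriple R⟧ := by
  have hmk : ∀ e : PrimTriple R, (⟦d⟧ : Orbits R) = ⟦e⟧ ↔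
      ∃ g : Rˣ × Perm (Fin 3), g • d = e := fun e => by
    rw [eq_comm, Quotient.eq]
    exact Iff.rfl
  constructor
  · intro h
    constructor
    · intro he
      obtain ⟨g, hg⟩ := (hmk _).1 he
      rw [← nondegenerate_smul_iff g, hg] at h
      exact h.2 2 (show -((1 : R) + -1) = 0 by ring)
    · intro he
      obtain ⟨g, hg⟩ := (hmk _).1 he
      rw [← nondegenerate_smul_iff g, hg] at h
      exact absurd (h.1 (show (doubleTriple R).1 0 = (doubleTriple R).1 1 from rfl)) (by decide)
  · rintro ⟨hz, hd⟩
    rw [Ne, hmk] at hz hd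
    have hmove : ∀ i j, i ≠ j → ∀ w, d.1 j = w * d.1 i →
        ∃ g : Rˣ × Perm (Fin 3), (g • d).1 0 = 1 ∧ (g • d).1 1 = w := fun i j hij w hw => by
      have hperm : ∀ i j : Fin 3, i ≠ j → ∃ σ : Perm (Fin 3), σ⁻¹ 0 = i ∧ σ⁻¹ 1 = j := by decide
      obtain ⟨σ, rfl, rfl⟩ := hperm i j hij
      have hu := (((1, σ) : Rˣ × Perm (Fin 3)) • d).isUnit_zero_of_one_eq (u := w) (by
        simpa only [smul_apply, Units.val_one, one_mul] using hw)
      simp only [smul_apply, Units.val_one, one_mul] at hu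
      obtain ⟨u, hu⟩ := hu
      refine ⟨(u⁻¹, σ), ?_, ?_⟩ <;> simp only [smul_apply, hw, ← hu]
      · exact u.inv_mul
      · rw [mul_left_comm, u.inv_mul, mul_one]
    have hopp : ∀ i j, i ≠ j → d.1 j ≠ -d.1 i := fun i j hij h => by
      obtain ⟨g, h0, h1⟩ := hmove i j hij (-1) (by rw [h, neg_one_mul])
      exact hz ⟨g, ext_pair h0 h1⟩
    have hsum := d.sum_val
    rw [Fin.sum_univ_three] at hsum
    refine ⟨fun i j h => ?_, fun i h => ?_⟩
    · by_contra hij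
      obtain ⟨g, h0, h1⟩ := hmove i j hij 1 (by rw [h, one_mul])
      exact hd ⟨g, ext_pair h0 h1⟩
    · match i, h with
      | 0, h => exact hopp 1 2 (by decide) (by linear_combination hsum - h)
      | 1, h => exact hopp 0 2 (by decide) (by linear_combination hsum - h)
      | 2, h => exact hopp 0 1 (by decide) (by linear_combination hsum - h)

lemma orbit_zeroTriple_ne_orbit_doubleTriple [Nontrivial R] (h2 : IsUnit (2 : R)) :
    (⟦zeroTriple R⟧ : Orbits R) ≠ ⟦doubleTriple R⟧ := by
  intro h
  obtain ⟨g, hg⟩ : ∃ g : Rˣ × Perm (Fin 3), g • doubleTriple R = zeroTriple R :=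
    Quotient.eq.1 h
  have h0 : g.1 * (doubleTriple R).1 (g.2⁻¹ 2) = 0 := by
    rw [← smul_apply, hg]
    change -((1 : R) + -1) = 0
    ring
  rw [g.1.mul_right_eq_zero] at h0
  generalize g.2⁻¹ 2 = i at h0
  fin_cases i
  · exact one_ne_zero h0
  · exact one_ne_zero h0
  · have h0' : -((1 : R) + 1) = 0 := h0
    exact h2.ne_zero (by linear_combination -h0')

end Degenerate

end PrimTriple

section Orbits

variable {v : ℕ}

lemma exists_enumeration (X : Bcon3 v) :
    ∃ x : Fin 3 → ZMod v, Function.Injective x ∧ Finset.univ.image x = X.1 := by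
  have e := X.1.equivFinOfCardEq X.2.1
  refine ⟨fun i => e.symm i, Subtype.val_injective.comp e.symm.injective, ?_⟩
  ext z
  simp only [Finset.mem_image, Finset.mem_univ, true_and]
  exact ⟨by rintro ⟨i, rfl⟩; exact (e.symm i).2, fun hz => ⟨e ⟨z, hz⟩, by simp⟩⟩

/-- An enumeration of a base line. -/
noncomputable def enum (X : Bcon3 v) : Fin 3 → ZMod v := (exists_enumeration X).choose

lemma enum_injective (X : Bcon3 v) : Function.Injective (enum X) :=
  (exists_enumeration X).choose_spec.1

lemma image_enum (X : Bcon3 v) : Finset.univ.image (enum X) = X.1 :=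
  (exists_enumeration X).choose_spec.2

/-- The triple of differences of a base line, in some order. -/
noncomputable def differences (X : Bcon3 v) : PrimTriple (ZMod v) where
  val := delta (enum X)
  sum_val := sum_delta _
  exists_sum_mul := by
    rw [← closure_image_sub_image_eq_top_iff, image_enum]
    exact X.2.2.2

lemma mk_differences_eq_mk_iff (X : Bcon3 v) (d : PrimTriple (ZMod v)) {y : Fin 3 → ZMod v}
    (hy : Function.Injective y) (hd : d.1 = delta y) :
    (⟦differences X⟧ : PrimTriple.Orbits (ZMod v)) = ⟦d⟧ ↔
      ∃ (a : (ZMod v)ˣ) (b : ZMod v),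
        Finset.univ.image y = X.1.image fun t => (a : ZMod v) * t + b := by
  rw [← image_enum X, image_affine_iff (enum_injective X) hy, eq_comm, Quotient.eq]
  refine exists_congr fun g => ⟨fun h i => ?_, fun h => PrimTriple.ext fun i => ?_⟩
  · rw [← hd, ← h]
    rfl
  · rw [hd, h]
    rfl

lemma mk_differences_eq_iff_affRel3 (X Y : Bcon3 v) :
    (⟦differences X⟧ : PrimTriple.Orbits (ZMod v)) = ⟦differences Y⟧ ↔ affRel3 v X Y := by
  rw [mk_differences_eq_mk_iff X _ (enum_injective Y) rfl, image_enum]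
  rfl

/-- The map sending the class of a base line to the orbit of its differences. -/
noncomputable def classToOrbit (v : ℕ) : Quot (affRel3 v) → PrimTriple.Orbits (ZMod v) :=
  Quot.lift (fun X => ⟦differences X⟧) fun X Y => (mk_differences_eq_iff_affRel3 X Y).2

lemma classToOrbit_injective (v : ℕ) : Function.Injective (classToOrbit v) := by
  rintro ⟨X⟩ ⟨Y⟩ h
  exact Quot.sound ((mk_differences_eq_iff_affRel3 X Y).1 h)

lemma nondegenerate_differences (h2 : IsUnit (2 : ZMod v)) (X : Bcon3 v) :
    (differences X).Nondegenerate := by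
  refine (card_image_sub_image_eq_seven_iff h2 (enum X)).1 ?_
  rw [image_enum]
  exact X.2.2.1

lemma range_classToOrbit (h2 : IsUnit (2 : ZMod v)) :
    Set.range (classToOrbit v) =
      {⟦PrimTriple.zeroTriple (ZMod v)⟧, ⟦PrimTriple.doubleTriple (ZMod v)⟧}ᶜ := by
  ext ω
  simp only [Set.mem_range, Set.mem_compl_iff, Set.mem_insert_iff, Set.mem_singleton_iff, not_or]
  constructor
  · rintro ⟨⟨X⟩, rfl⟩
    exact (PrimTriple.nondegenerate_iff _).1 (nondegenerate_differences h2 X)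
  · induction ω using Quotient.inductionOn with | _ d => ?_
    intro h
    have hd := (PrimTriple.nondegenerate_iff d).2 h
    have hdelta : delta (antiDelta d.1) = d.1 := delta_antiDelta d.sum_val
    have hinj : Function.Injective (antiDelta d.1) :=
      (injective_iff_delta_ne_zero _).2 (by rw [hdelta]; exact hd.2)
    refine ⟨Quot.mk _ ⟨Finset.univ.image (antiDelta d.1), ?_, ?_, ?_⟩, ?_⟩
    · rw [Finset.card_image_of_injective _ hinj, Finset.card_univ, Fintype.card_fin]
    · rw [card_image_sub_image_eq_seven_iff h2, hdelta]
      exact hd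
    · rw [closure_image_sub_image_eq_top_iff, hdelta]
      exact d.exists_sum_mul
    · exact (mk_differences_eq_mk_iff _ d hinj hdelta.symm).2 ⟨1, 0, by simp⟩

lemma numOrbits3_add_two [NeZero v] [Nontrivial (ZMod v)] (h2 : IsUnit (2 : ZMod v)) :
    numOrbits3 v + 2 = Nat.card (PrimTriple.Orbits (ZMod v)) := by
  have : Finite (PrimTriple.Orbits (ZMod v)) := Quotient.finite _
  rw [← Set.ncard_add_ncard_compl (Set.range (classToOrbit v)), Set.ncard_range_of_injective
    (classToOrbit_injective v), range_classToOrbit h2, compl_compl,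
    Set.ncard_pair (PrimTriple.orbit_zeroTriple_ne_orbit_doubleTriple h2), numOrbits3]

end Orbits

end CyclicConf

/-- for odd `v > 4` with `3 ∥ v` (i.e. `3 ∣ v`, `9 ∤ v`) and all other
prime divisors `≡ 1 (mod 3)`, the number of isomorphism classes of connected cyclic
configurations of type (v₃) is `(1/6)·v·∏(1 + 1/pᵢ) + (2/3)·2^k - 2`. -/
theorem numOrbits3_odd_three_exactly_once
    (v : ℕ) (hv : 4 < v) (hodd : Odd v)
    (h3 : 3 ∣ v) (h9 : ¬ (9 ∣ v))
    (hp : ∀ p ∈ v.primeFactors, p ≠ 3 → p % 3 = 1) :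
    (numOrbits3 v : ℚ) =
      (v : ℚ) / 6 * (∏ p ∈ v.primeFactors, (1 + 1 / (p : ℚ)))
        + 2 / 3 * 2 ^ v.primeFactors.card - 2 := by
  have h0 : v ≠ 0 := by omega
  have : NeZero v := ⟨h0⟩
  have : Fact (1 < v) := ⟨by omega⟩
  have h2 : IsUnit (2 : ZMod v) := by
    have h := (ZMod.isUnit_iff_coprime 2 v).2 (Nat.coprime_two_left.2 hodd)
    exact_mod_cast h
  have hnum := CyclicConf.numOrbits3_add_two h2
  have hcard := CyclicConf.PrimTriple.card_orbits (R := ZMod v)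
  have hpairs := CyclicConf.card_coprimePairs_zmod h0
  have hcubic := CyclicConf.card_cubicRoots_zmod h3 h9 hp
  rw [← hnum, CyclicConf.card_sqrtsOfOne_zmod hodd, Nat.card_eq_fintype_card (α := (ZMod v)ˣ),
    ZMod.card_units_eq_totient] at hcard
  have hcard' := congrArg (Nat.cast : ℕ → ℚ) hcard
  have hcubic' := congrArg (Nat.cast : ℕ → ℚ) hcubic
  push_cast at hcard' hcubic'
  rw [hpairs] at hcard'
  have hφ : (v.totient : ℚ) ≠ 0 := Nat.cast_ne_zero.2 (Nat.totient_pos.2 (by omega)).ne'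
  refine mul_left_cancel₀ hφ ?_
  linear_combination hcard' / 6 + v.totient * hcubic' / 6
end

section
/- Let v > 4 be an odd integer with prime factorization v = p₁^{n₁}···p_k^{n_k} such that either v ≡ 0 (mod 9), or some prime p_i ≡ 2 (mod 3), (i.e., neither all p_i ≡ 1 (mod 3), nor p₁^{n₁} = 3 with all other p_i ≡ 1 (mod 3)). Then the number of orbits of the affine group AGL₁(v) acting on B_con(v,3) — equivalently, the number of isomorphism classes of connected cyclic configurations of type (v_3) — equals (1/6)·v·∏_{i=1}^{k}(1 + 1/p_i) + (1/2)·2^k − 2. -/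
open scoped Pointwise

/-- Triples with zero sum whose entries generate the unit ideal. -/
def UnimodularTriple (R : Type*) [CommRing R] : Type _ :=
  {f : Fin 3 → R // ∑ i, f i = 0 ∧ ∃ c : Fin 3 → R, ∑ i, c i * f i = 1}

namespace UnimodularTriple

open Equiv

section Ring

variable {R : Type*} [CommRing R]

instance : MulAction (Rˣ × Perm (Fin 3)) (UnimodularTriple R) where
  smul g f := ⟨fun i => g.1 * f.1 (g.2⁻¹ i), by
    obtain ⟨f, hf, c, hc⟩ := f
    refine ⟨?_, fun i => (g.1⁻¹ : Rˣ) * c (g.2⁻¹ i), ?_⟩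
    · rw [← Finset.mul_sum, Equiv.sum_comp g.2⁻¹ f, hf, mul_zero]
    · refine Eq.trans ?_ ((Equiv.sum_comp g.2⁻¹ fun i => c i * f i).trans hc)
      refine Finset.sum_congr rfl fun i _ => ?_
      linear_combination (c (g.2⁻¹ i) * f (g.2⁻¹ i)) * g.1.inv_mul⟩
  one_smul f := Subtype.ext <| funext fun i => by
    change ((1 : Rˣ) : R) * f.1 _ = f.1 i
    simp
  mul_smul g h f := Subtype.ext <| funext fun i => by
    change ((g.1 * h.1 : Rˣ) : R) * f.1 ((g.2 * h.2)⁻¹ i) = g.1 * (h.1 * f.1 (h.2⁻¹ (g.2⁻¹ i)))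
    simp [mul_assoc]

theorem sum_eq_zero (f : UnimodularTriple R) : ∑ i, f.1 i = 0 := f.2.1

theorem apply_zero_add (f : UnimodularTriple R) : f.1 0 + f.1 1 + f.1 2 = 0 := by
  have := f.sum_eq_zero
  rwa [Fin.sum_univ_three] at this

theorem eq_zero_of_forall_mul_eq_zero (f : UnimodularTriple R) {r : R}
    (h : ∀ i, r * f.1 i = 0) : r = 0 := by
  obtain ⟨c, hc⟩ := f.2.2
  calc r = r * ∑ i, c i * f.1 i := by rw [hc, mul_one]
    _ = ∑ i, c i * (r * f.1 i) := by
        rw [Finset.mul_sum]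
        exact Finset.sum_congr rfl fun i _ => by ring
    _ = 0 := by simp only [h, mul_zero, Finset.sum_const_zero]

theorem isUnit_of_forall_dvd (f : UnimodularTriple R) {r : R} (h : ∀ i, r ∣ f.1 i) :
    IsUnit r := by
  obtain ⟨c, hc⟩ := f.2.2
  exact isUnit_of_dvd_one (hc ▸ Finset.dvd_sum fun i _ => (h i).mul_left (c i))

theorem mem_fixedBy_iff {u : Rˣ} {σ : Perm (Fin 3)} {f : UnimodularTriple R} :
    f ∈ MulAction.fixedBy (UnimodularTriple R) (u, σ) ↔ ∀ i, u * f.1 (σ⁻¹ i) = f.1 i := by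
  rw [MulAction.mem_fixedBy]
  exact ⟨fun h i => congrFun (congrArg Subtype.val h) i, fun h => Subtype.ext (funext h)⟩

/-- Swapping the first two coordinates and scaling by `u` fixes exactly the unit multiples of
`(1, u, -1 - u)` if `u ^ 2 = 1`. -/
theorem card_fixedBy_of_sq_eq_one {u : Rˣ} (hu : u ^ 2 = 1) :
    Nat.card (MulAction.fixedBy (UnimodularTriple R) (u, swap (0 : Fin 3) 1)) = Nat.card Rˣ := by
  have hu' : (u : R) * u = 1 := by
    rw [← Units.val_mul, ← sq, hu, Units.val_one]
  have key (f : UnimodularTriple R) :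
      f ∈ MulAction.fixedBy (UnimodularTriple R) (u, swap (0 : Fin 3) 1) ↔
        u * f.1 0 = f.1 1 := by
    rw [mem_fixedBy_iff]
    refine ⟨fun h => by simpa using h 1, fun h => ?_⟩
    have hs := f.apply_zero_add
    have h2 : swap (0 : Fin 3) 1 2 = 2 := by decide
    intro i
    fin_cases i
    · simp [← h, ← mul_assoc, hu']
    · simpa using h
    · simp only [swap_inv, Fin.reduceFinMk, h2]
      linear_combination (u - 1 : R) * hs + (u - 1 : R) * h - f.1 0 * hu'
  symm
  refine Nat.card_congr (Equiv.ofBijective (fun a : Rˣ => ⟨⟨![a, u * a, -a - u * a], ?_, ?_⟩, ?_⟩)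
    ⟨?_, ?_⟩)
  · simp [Fin.sum_univ_three]
  · exact ⟨![(a⁻¹ : Rˣ), 0, 0], by simp [Fin.sum_univ_three]⟩
  · exact (key _).2 (by simp)
  · intro a b h
    exact Units.ext (congrFun (congrArg (fun x => x.1.1) h) 0)
  · rintro ⟨f, hf⟩
    rw [key] at hf
    have hs := f.apply_zero_add
    have h2 : f.1 2 = -f.1 0 - u * f.1 0 := by linear_combination hs + hf
    have hunit : IsUnit (f.1 0) := f.isUnit_of_forall_dvd fun i => by
      fin_cases i
      · exact dvd_rfl
      · exact ⟨u, by simp [← hf, mul_comm]⟩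
      · exact ⟨-1 - u, by simp only [Fin.reduceFinMk, h2]; ring⟩
    refine ⟨hunit.unit, Subtype.ext (Subtype.ext (funext fun i => ?_))⟩
    fin_cases i
    · simp
    · simpa using hf
    · simpa using h2.symm

theorem sq_eq_one_of_mem_fixedBy {u : Rˣ} {σ : Perm (Fin 3)} (hσ : σ ^ 2 = 1)
    {f : UnimodularTriple R} (hf : f ∈ MulAction.fixedBy (UnimodularTriple R) (u, σ)) :
    u ^ 2 = 1 := by
  rw [mem_fixedBy_iff] at hf
  have hσ' (i) : σ⁻¹ (σ⁻¹ i) = i := by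
    rw [← Perm.mul_apply, ← mul_inv_rev, ← sq, hσ, inv_one, Perm.one_apply]
  have : (u : R) ^ 2 - 1 = 0 := f.eq_zero_of_forall_mul_eq_zero fun i => by
    have h1 := hf i
    have h2 := hf (σ⁻¹ i)
    rw [hσ'] at h2
    linear_combination u * h2 + h1
  ext
  simpa using sub_eq_zero.1 this

theorem eq_one_of_mem_fixedBy {u : Rˣ} {f : UnimodularTriple R}
    (hf : f ∈ MulAction.fixedBy (UnimodularTriple R) (u, (1 : Perm (Fin 3)))) : u = 1 := by
  rw [mem_fixedBy_iff] at hf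
  refine Units.ext (sub_eq_zero.1 (f.eq_zero_of_forall_mul_eq_zero fun i => ?_))
  have := hf i
  simp only [inv_one, Perm.one_apply, Units.val_one] at this ⊢
  linear_combination this

theorem add_sq_eq_zero_of_mem_fixedBy {u : Rˣ} {σ : Perm (Fin 3)} (h1 : σ ≠ 1)
    (hσ : Perm.sign σ = 1) {f : UnimodularTriple R}
    (hf : f ∈ MulAction.fixedBy (UnimodularTriple R) (u, σ)) : 1 + (u : R) + u ^ 2 = 0 := by
  rw [mem_fixedBy_iff] at hf
  have key : ∀ σ : Perm (Fin 3), σ ≠ 1 → Perm.sign σ = 1 → ∀ i,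
      σ⁻¹ (σ⁻¹ i) ≠ i ∧ σ⁻¹ (σ⁻¹ i) ≠ σ⁻¹ i ∧ σ⁻¹ i ≠ i := by decide
  have hsum {i j k : Fin 3} (hij : k ≠ i) (hjk : k ≠ j) (hik : j ≠ i) :
      f.1 i + f.1 j + f.1 k = 0 := by
    have : ({i, j, k} : Finset (Fin 3)) = Finset.univ := by
      revert i j k; decide
    have hs := f.sum_eq_zero
    generalize f.1 = g at hs ⊢
    rwa [← this, Finset.sum_insert (by simp [hij.symm, hik.symm]),
      Finset.sum_pair hjk.symm, ← add_assoc] at hs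
  refine f.eq_zero_of_forall_mul_eq_zero fun i => ?_
  have h (i) : f.1 i = u * f.1 (σ⁻¹ i) := (hf i).symm
  obtain ⟨hki, hkj, hji⟩ := key σ h1 hσ i
  linear_combination (u : R) ^ 2 * hsum hki hkj hji + (u + 1 : R) * h i + u * h (σ⁻¹ i)

theorem card_fixedBy_of_sign [Finite R] {σ : Perm (Fin 3)} (hσ : Perm.sign σ = -1) (u : Rˣ) :
    Nat.card (MulAction.fixedBy (UnimodularTriple R) (u, σ)) =
      Nat.card (MulAction.fixedBy (UnimodularTriple R) (u, swap (0 : Fin 3) 1)) := by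
  have key : ∀ σ : Perm (Fin 3), Perm.sign σ = -1 → ∃ τ : Perm (Fin 3),
      σ = τ * swap 0 1 * τ⁻¹ := by decide
  obtain ⟨τ, rfl⟩ := key σ hσ
  have := MulAction.smul_fixedBy (α := UnimodularTriple R) ((u, swap 0 1) : Rˣ × Perm (Fin 3))
    ((1, τ) : Rˣ × Perm (Fin 3))
  simp only [Prod.mk_mul_mk, Prod.inv_mk, one_mul, inv_one, mul_one] at this
  rw [← this]
  exact Set.natCard_smul_set _ _

instance [Finite R] : Finite (UnimodularTriple R) := Subtype.finite

open Classical in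
/-- The Burnside count of the orbits when `1 + X + X ^ 2` has no unit root. -/
theorem card_orbits_mul [Finite R] (hR : ∀ u : Rˣ, 1 + (u : R) + u ^ 2 ≠ 0) :
    Nat.card (MulAction.orbitRel.Quotient (Rˣ × Perm (Fin 3)) (UnimodularTriple R)) *
      (6 * Nat.card Rˣ) =
    Nat.card (UnimodularTriple R) +
      3 * (Nat.card Rˣ * Nat.card {u : Rˣ // u ^ 2 = 1}) := by
  have := Fintype.ofFinite R
  have := Fintype.ofFinite (UnimodularTriple R)
  have B := MulAction.sum_card_fixedBy_eq_card_orbits_mul_card_group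
    (Rˣ × Perm (Fin 3)) (UnimodularTriple R)
  rw [Fintype.card_prod, Fintype.card_perm, Fintype.card_fin, Fintype.sum_prod_type_right] at B
  simp only [← Nat.card_eq_fintype_card] at B
  rw [mul_comm 6, show (6 : ℕ) = Nat.factorial 3 from rfl]
  refine Eq.trans B.symm ?_
  have inner (σ : Perm (Fin 3)) :
      ∑ u : Rˣ, Nat.card (MulAction.fixedBy (UnimodularTriple R) (u, σ)) =
        (if σ = 1 then Nat.card (UnimodularTriple R) else 0) +
        (if Perm.sign σ = -1 then Nat.card Rˣ * Nat.card {u : Rˣ // u ^ 2 = 1} else 0) := by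
    rcases Int.units_eq_one_or (Perm.sign σ) with hs | hs
    · rw [if_neg (c := Perm.sign σ = -1) (by rw [hs]; decide), add_zero]
      split_ifs with h1
      · subst h1
        rw [Finset.sum_eq_single 1]
        · rw [show ((1, 1) : Rˣ × Perm (Fin 3)) = 1 from rfl, MulAction.fixedBy_one_eq_univ,
            Nat.card_univ]
        · intro u _ hu
          rw [Nat.card_eq_zero]
          exact .inl ⟨fun f => hu (eq_one_of_mem_fixedBy f.2)⟩
        · simp
      · refine Finset.sum_eq_zero fun u _ => ?_
        rw [Nat.card_eq_zero]
        exact .inl ⟨fun f => hR u (add_sq_eq_zero_of_mem_fixedBy h1 hs f.2)⟩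
    · rw [if_pos hs, if_neg (by rintro rfl; simp at hs), zero_add]
      have (u : Rˣ) : Nat.card (MulAction.fixedBy (UnimodularTriple R) (u, σ)) =
          if u ^ 2 = 1 then Nat.card Rˣ else 0 := by
        rw [card_fixedBy_of_sign hs]
        split_ifs with hu
        · exact card_fixedBy_of_sq_eq_one hu
        · rw [Nat.card_eq_zero]
          exact .inl ⟨fun f => hu (sq_eq_one_of_mem_fixedBy (by decide) f.2)⟩
      simp only [this]
      rw [← Finset.sum_filter, Finset.sum_const, Nat.card_eq_fintype_card (α := {u : Rˣ // _}),
        Fintype.card_subtype, smul_eq_mul, mul_comm]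
  simp only [inner]
  rw [Finset.sum_add_distrib, Finset.sum_ite_eq' Finset.univ, if_pos (Finset.mem_univ _),
    ← Finset.sum_filter, Finset.sum_const, smul_eq_mul]
  congr 2

end Ring

/-- A triple with zero sum is determined by its first two entries. -/
def equivCoprimePairs (R : Type*) [CommRing R] :
    UnimodularTriple R ≃ {x : R × R // IsCoprime x.1 x.2} where
  toFun f := ⟨(f.1 0, f.1 1), by
    obtain ⟨c, hc⟩ := f.2.2
    rw [Fin.sum_univ_three] at hc
    exact ⟨c 0 - c 2, c 1 - c 2, by linear_combination hc - c 2 * f.apply_zero_add⟩⟩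
  invFun x := ⟨![x.1.1, x.1.2, -x.1.1 - x.1.2], by simp [Fin.sum_univ_three], by
    obtain ⟨r, s, h⟩ := x.2
    exact ⟨![r, s, 0], by simpa [Fin.sum_univ_three] using h⟩⟩
  left_inv f := Subtype.ext <| funext fun i => by
    fin_cases i
    · rfl
    · rfl
    · change -f.1 0 - f.1 1 = f.1 2
      linear_combination -f.apply_zero_add
  right_inv x := rfl

end UnimodularTriple

theorem Prod.isCoprime_iff {R S : Type*} [CommSemiring R] [CommSemiring S] {x y : R × S} :
    IsCoprime x y ↔ IsCoprime x.1 y.1 ∧ IsCoprime x.2 y.2 := by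
  constructor
  · exact fun h => ⟨h.map (RingHom.fst R S), h.map (RingHom.snd R S)⟩
  · rintro ⟨⟨a, b, h⟩, c, d, h'⟩
    exact ⟨(a, c), (b, d), Prod.ext h h'⟩

theorem RingEquiv.isCoprime_iff {R S : Type*} [CommSemiring R] [CommSemiring S] (e : R ≃+* S)
    {x y : R} : IsCoprime (e x) (e y) ↔ IsCoprime x y :=
  ⟨fun h => by simpa using h.map (e.symm : S →+* R), fun h => h.map (e : R →+* S)⟩

namespace ZMod

theorem isUnit_prime_pow_iff {p n : ℕ} [Fact p.Prime] (hn : n ≠ 0) (a : ZMod (p ^ n)) :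
    IsUnit a ↔ castHom (dvd_pow_self p hn) (ZMod p) a ≠ 0 := by
  have hp : p.Prime := Fact.out
  have : NeZero (p ^ n) := ⟨pow_ne_zero _ hp.ne_zero⟩
  obtain ⟨m, rfl⟩ := natCast_zmod_surjective a
  rw [isUnit_iff_coprime, map_natCast, Ne, natCast_eq_zero_iff,
    Nat.coprime_pow_right_iff (Nat.pos_of_ne_zero hn), Nat.coprime_comm, hp.coprime_iff_not_dvd]

theorem isCoprime_prime_pow_iff {p n : ℕ} [Fact p.Prime] (hn : n ≠ 0) (a b : ZMod (p ^ n)) :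
    IsCoprime a b ↔ IsUnit a ∨ IsUnit b := by
  refine ⟨fun h => ?_, ?_⟩
  · have := h.map (castHom (dvd_pow_self p hn) (ZMod p))
    rw [isUnit_prime_pow_iff hn, isUnit_prime_pow_iff hn]
    exact this.ne_zero_or_ne_zero
  · rintro (h | h)
    · exact ⟨(h.unit⁻¹ : (ZMod (p ^ n))ˣ), 0, by simp⟩
    · exact ⟨0, (h.unit⁻¹ : (ZMod (p ^ n))ˣ), by simp⟩

theorem card_coprimePairs_mul {m n : ℕ} (h : m.Coprime n) :
    Nat.card {x : ZMod (m * n) × ZMod (m * n) // IsCoprime x.1 x.2} =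
      Nat.card {x : ZMod m × ZMod m // IsCoprime x.1 x.2} *
        Nat.card {x : ZMod n × ZMod n // IsCoprime x.1 x.2} := by
  let e := chineseRemainder h
  rw [← Nat.card_prod]
  refine Nat.card_congr (Equiv.trans (Equiv.subtypeEquiv
    ((e.toEquiv.prodCongr e.toEquiv).trans (Equiv.prodProdProdComm _ _ _ _)) fun x => ?_)
    Equiv.subtypeProdEquivProd)
  rw [← e.isCoprime_iff, Prod.isCoprime_iff]
  rfl

theorem card_sq_eq_one_mul {m n : ℕ} (h : m.Coprime n) :
    Nat.card {u : (ZMod (m * n))ˣ // u ^ 2 = 1} =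
      Nat.card {u : (ZMod m)ˣ // u ^ 2 = 1} * Nat.card {u : (ZMod n)ˣ // u ^ 2 = 1} := by
  let e := (Units.mapEquiv (chineseRemainder h).toMulEquiv).trans MulEquiv.prodUnits
  rw [← Nat.card_prod]
  refine Nat.card_congr (Equiv.trans (Equiv.subtypeEquiv e.toEquiv fun u => ?_)
    Equiv.subtypeProdEquivProd)
  rw [← e.map_eq_one_iff, map_pow, Prod.ext_iff]
  rfl

theorem card_sq_eq_one_prime_pow {p n : ℕ} [Fact p.Prime] (hp2 : p ≠ 2) (hn : n ≠ 0) :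
    Nat.card {u : (ZMod (p ^ n))ˣ // u ^ 2 = 1} = 2 := by
  have hp : p.Prime := Fact.out
  have : NeZero (p ^ n) := ⟨pow_ne_zero _ hp.ne_zero⟩
  have h2 : (2 : ZMod p) ≠ 0 := by
    intro h
    have : p ∣ 2 := (natCast_eq_zero_iff 2 p).1 (mod_cast h)
    exact hp2 ((Nat.prime_dvd_prime_iff_eq hp Nat.prime_two).1 this)
  have hne : (1 : (ZMod (p ^ n))ˣ) ≠ -1 := by
    intro h
    have := congrArg (fun u : (ZMod (p ^ n))ˣ => castHom (dvd_pow_self p hn) (ZMod p) u) h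
    simp only [Units.val_one, map_one, Units.val_neg, map_neg] at this
    exact h2 (by linear_combination this)
  have hset : {u : (ZMod (p ^ n))ˣ | u ^ 2 = 1} = {1, -1} := by
    ext u
    simp only [Set.mem_ofPred_eq, Set.mem_insert_iff, Set.mem_singleton_iff]
    refine ⟨fun h => ?_, by rintro (rfl | rfl) <;> simp⟩
    have hu : ((u : ZMod (p ^ n)) - 1) * (u + 1) = 0 := by
      have : (u : ZMod (p ^ n)) ^ 2 = 1 := by rw [← Units.val_pow_eq_pow_val, h, Units.val_one]
      linear_combination this
    by_cases hu1 : IsUnit ((u : ZMod (p ^ n)) - 1)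
    · right
      ext
      rw [hu1.mul_right_eq_zero] at hu
      simpa using eq_neg_of_add_eq_zero_left hu
    · have hu2 : IsUnit ((u : ZMod (p ^ n)) + 1) := by
        rw [isUnit_prime_pow_iff hn] at hu1 ⊢
        simp only [map_sub, map_one, ne_eq, not_not, map_add] at hu1 ⊢
        intro h'
        exact h2 (by linear_combination h' - hu1)
      left
      ext
      rw [hu2.mul_left_eq_zero] at hu
      simpa using sub_eq_zero.1 hu
  change Nat.card ↥{u : (ZMod (p ^ n))ˣ | u ^ 2 = 1} = 2
  rw [hset, Nat.card_coe_set_eq, Set.ncard_pair hne]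

theorem card_sq_eq_one {v : ℕ} (hv : Odd v) :
    Nat.card {u : (ZMod v)ˣ // u ^ 2 = 1} = 2 ^ v.primeFactors.card := by
  induction v using Nat.recOnPosPrimePosCoprime with
  | prime_pow p n hp hn =>
    have := Fact.mk hp
    rw [card_sq_eq_one_prime_pow _ hn.ne', Nat.primeFactors_prime_pow hn.ne' hp,
      Finset.card_singleton, pow_one]
    rintro rfl
    exact absurd ((Nat.odd_pow_iff hn.ne').1 hv) (by decide)
  | zero => exact absurd hv (by decide)
  | one =>
    rw [Nat.primeFactors_one, Finset.card_empty, pow_zero, Nat.card_eq_one_iff_unique]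
    exact ⟨inferInstance, ⟨1, one_pow 2⟩⟩
  | coprime a b _ _ hab iha ihb =>
    rw [Nat.odd_mul] at hv
    rw [card_sq_eq_one_mul hab, iha hv.1, ihb hv.2, hab.primeFactors_mul,
      Finset.card_union_of_disjoint hab.disjoint_primeFactors, pow_add]

theorem card_coprimePairs_prime_pow {p n : ℕ} [Fact p.Prime] (hn : n ≠ 0) :
    Nat.card {x : ZMod (p ^ n) × ZMod (p ^ n) // IsCoprime x.1 x.2} +
      (p ^ (n - 1)) ^ 2 = (p ^ n) ^ 2 := by
  classical
  have hp : p.Prime := Fact.out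
  have : NeZero (p ^ n) := ⟨pow_ne_zero _ hp.ne_zero⟩
  have h1 : Nat.card {a : ZMod (p ^ n) // IsUnit a} = Nat.totient (p ^ n) := by
    rw [← card_units_eq_totient, ← Nat.card_eq_fintype_card]
    exact Nat.card_congr (Equiv.ofBijective
      (fun a => a.2.unit) ⟨fun a b h => Subtype.ext (congrArg Units.val h),
        fun u => ⟨⟨u, u.isUnit⟩, Units.ext rfl⟩⟩)
  have h2 : Nat.card {a : ZMod (p ^ n) // IsUnit a} + Nat.card {a : ZMod (p ^ n) // ¬ IsUnit a} =
      p ^ n := by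
    rw [← Nat.card_sum, Nat.card_congr (Equiv.sumCompl _), Nat.card_zmod]
  have h3 : Nat.card {a : ZMod (p ^ n) // ¬ IsUnit a} = p ^ (n - 1) := by
    obtain ⟨k, rfl⟩ := Nat.exists_eq_succ_of_ne_zero hn
    obtain ⟨q, rfl⟩ := Nat.exists_eq_succ_of_ne_zero hp.ne_zero
    rw [h1, Nat.totient_prime_pow_succ hp] at h2
    simp only [Nat.succ_eq_add_one, Nat.add_sub_cancel] at h2 ⊢
    rw [pow_succ] at h2
    exact Nat.add_left_cancel (h2.trans (mul_add_one _ _))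
  have h4 : Nat.card {x : ZMod (p ^ n) × ZMod (p ^ n) // ¬ IsCoprime x.1 x.2} =
      (p ^ (n - 1)) ^ 2 := by
    rw [sq, ← h3, ← Nat.card_prod]
    refine Nat.card_congr (Equiv.trans (Equiv.subtypeEquivRight fun x => ?_)
      Equiv.subtypeProdEquivProd)
    rw [isCoprime_prime_pow_iff hn, not_or]
  rw [← h4, ← Nat.card_sum, Nat.card_congr (Equiv.sumCompl _), Nat.card_prod, Nat.card_zmod, sq]

/-- The number of coprime pairs is the Jordan totient `J₂(v)`. -/
theorem card_coprimePairs {v : ℕ} (hv : v ≠ 0) :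
    (Nat.card {x : ZMod v × ZMod v // IsCoprime x.1 x.2} : ℚ) =
      v.totient * (v * ∏ p ∈ v.primeFactors, (1 + 1 / (p : ℚ))) := by
  induction v using Nat.recOnPosPrimePosCoprime with
  | prime_pow p n hp hn =>
    have := Fact.mk hp
    have h : ((_ : ℕ) : ℚ) = _ := congrArg _ (card_coprimePairs_prime_pow (p := p) hn.ne')
    obtain ⟨k, rfl⟩ := Nat.exists_eq_succ_of_ne_zero hn.ne'
    have hp0 : (p : ℚ) ≠ 0 := mod_cast hp.ne_zero
    rw [Nat.primeFactors_prime_pow hn.ne' hp, Finset.prod_singleton,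
      Nat.totient_prime_pow_succ hp]
    push_cast [hp.one_le] at h ⊢
    simp only [Nat.succ_eq_add_one] at h ⊢
    rw [eq_sub_of_add_eq h]
    field_simp
    ring
  | zero => exact absurd rfl hv
  | one =>
    have : Nat.card {x : ZMod 1 × ZMod 1 // IsCoprime x.1 x.2} = 1 := by
      rw [Nat.card_eq_one_iff_unique]
      exact ⟨inferInstance, ⟨0, 0, 0, rfl⟩⟩
    simp [this]
  | coprime a b ha hb hab iha ihb =>
    rw [card_coprimePairs_mul hab, hab.primeFactors_mul,
      Finset.prod_union hab.disjoint_primeFactors, Nat.totient_mul hab]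
    push_cast
    rw [iha (by omega), ihb (by omega)]
    ring

theorem one_add_add_sq_ne_zero {v : ℕ} (hv : 9 ∣ v ∨ ∃ p ∈ v.primeFactors, p % 3 = 2)
    (u : ZMod v) : 1 + u + u ^ 2 ≠ 0 := by
  intro h
  rcases hv with h9 | ⟨p, hp, hp3⟩
  · have := congrArg (castHom h9 (ZMod 9)) h
    simp only [map_add, map_one, map_pow, map_zero] at this
    revert this
    generalize castHom h9 (ZMod 9) u = w
    revert w
    decide
  · have := Fact.mk (Nat.prime_of_mem_primeFactors hp)
    have hw := congrArg (castHom (Nat.dvd_of_mem_primeFactors hp) (ZMod p)) h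
    simp only [map_add, map_one, map_pow, map_zero] at hw
    generalize castHom (Nat.dvd_of_mem_primeFactors hp) (ZMod p) u = w at hw
    have hw0 : w ≠ 0 := by rintro rfl; simp at hw
    have hw1 : w ≠ 1 := by
      rintro rfl
      have h3 : ((3 : ℕ) : ZMod p) = 0 := by push_cast; linear_combination hw
      rw [natCast_eq_zero_iff, Nat.prime_dvd_prime_iff_eq Fact.out Nat.prime_three] at h3
      omega
    have h3 : orderOf w = 3 := orderOf_eq_prime (by linear_combination (w - 1) * hw) hw1
    have := orderOf_dvd_card_sub_one hw0
    rw [h3] at this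
    omega

end ZMod

namespace Bcon3

open Equiv

/-- The cyclic differences of a triple. -/
def cycDiff {R : Type*} [Sub R] (x : Fin 3 → R) (i : Fin 3) : R := x (i + 1) - x (i + 2)

variable {v : ℕ}

theorem sum_cycDiff (x : Fin 3 → ZMod v) : ∑ i, cycDiff x i = 0 := by
  simp only [cycDiff, Finset.sum_sub_distrib]
  exact sub_eq_zero.2 ((Equiv.sum_comp (Equiv.addRight (1 : Fin 3)) x).trans
    (Equiv.sum_comp (Equiv.addRight (2 : Fin 3)) x).symm)

theorem exists_cycDiff_eq {f : Fin 3 → ZMod v} (hf : ∑ i, f i = 0) : ∃ x, cycDiff x = f := by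
  rw [Fin.sum_univ_three] at hf
  refine ⟨![0, -f 2, f 1], funext fun i => ?_⟩
  fin_cases i
  · change -f 2 - f 1 = f 0
    linear_combination -hf
  · exact sub_zero (f 1)
  · change 0 - -f 2 = f 2
    ring

theorem exists_cycDiff_comp (σ : Perm (Fin 3)) :
    ∃ ε : (ZMod v)ˣ, ∀ x : Fin 3 → ZMod v, ∀ i, cycDiff (x ∘ σ) i = ε * cycDiff x (σ i) := by
  have key : ∀ σ : Perm (Fin 3), (∀ i, σ (i + 1) = σ i + 1 ∧ σ (i + 2) = σ i + 2) ∨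
      (∀ i, σ (i + 1) = σ i + 2 ∧ σ (i + 2) = σ i + 1) := by decide
  rcases key σ with h | h
  · exact ⟨1, fun x i => by simp [cycDiff, h]⟩
  · exact ⟨-1, fun x i => by simp [cycDiff, h]⟩

theorem eq_add_of_cycDiff_eq {x y : Fin 3 → ZMod v} {a : ZMod v}
    (h : ∀ i, cycDiff y i = a * cycDiff x i) (i : Fin 3) : y i = a * x i + (y 0 - a * x 0) := by
  have h1 : y 2 - y 0 = a * (x 2 - x 0) := h 1
  have h2 : y 0 - y 1 = a * (x 0 - x 1) := h 2
  fin_cases i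
  · simp
  · simp only [Fin.mk_one]; linear_combination -h2
  · simp only [Fin.reduceFinMk]; linear_combination h1

/-- All entries are nonzero and pairwise distinct. -/
def Generic {R : Type*} [Zero R] (f : Fin 3 → R) : Prop :=
  (∀ i, f i ≠ 0) ∧ Function.Injective f

theorem image_sub_image (x : Fin 3 → ZMod v) :
    Finset.univ.image x - Finset.univ.image x = ({0, cycDiff x 0, cycDiff x 1, cycDiff x 2,
      -cycDiff x 0, -cycDiff x 1, -cycDiff x 2} : Multiset (ZMod v)).toFinset := by
  ext t
  simp only [Finset.mem_sub, Finset.mem_image, Finset.mem_univ, true_and,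
    Multiset.mem_toFinset, Multiset.insert_eq_cons, Multiset.mem_cons, Multiset.mem_singleton]
  constructor
  · rintro ⟨_, ⟨i, rfl⟩, _, ⟨j, rfl⟩, rfl⟩
    fin_cases i <;> fin_cases j <;> simp [cycDiff]
  · rintro (rfl | rfl | rfl | rfl | rfl | rfl | rfl)
    · exact ⟨x 0, ⟨0, rfl⟩, x 0, ⟨0, rfl⟩, sub_self _⟩
    · exact ⟨x 1, ⟨1, rfl⟩, x 2, ⟨2, rfl⟩, rfl⟩
    · exact ⟨x 2, ⟨2, rfl⟩, x 0, ⟨0, rfl⟩, rfl⟩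
    · exact ⟨x 0, ⟨0, rfl⟩, x 1, ⟨1, rfl⟩, rfl⟩
    · exact ⟨x 2, ⟨2, rfl⟩, x 1, ⟨1, rfl⟩, (neg_sub _ _).symm⟩
    · exact ⟨x 0, ⟨0, rfl⟩, x 2, ⟨2, rfl⟩, (neg_sub _ _).symm⟩
    · exact ⟨x 1, ⟨1, rfl⟩, x 0, ⟨0, rfl⟩, (neg_sub _ _).symm⟩

theorem card_sub_iff (hodd : Odd v) (x : Fin 3 → ZMod v) :
    (Finset.univ.image x - Finset.univ.image x).card = 7 ↔ Generic (cycDiff x) := by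
  have hs := sum_cycDiff x
  rw [Fin.sum_univ_three] at hs
  rw [image_sub_image]
  generalize cycDiff x = f at *
  rw [show (7 : ℕ) = Multiset.card ({0, f 0, f 1, f 2, -f 0, -f 1, -f 2} : Multiset (ZMod v))
    from rfl, Multiset.toFinset_card_eq_card_iff_nodup]
  simp only [Multiset.insert_eq_cons, Multiset.nodup_cons, Multiset.mem_cons,
    Multiset.mem_singleton, Multiset.nodup_singleton, not_or, and_true, neg_inj, ← ne_eq,
    ne_comm (a := (0 : ZMod v)), neg_ne_zero]
  constructor
  · rintro ⟨⟨h0, h1, h2, -⟩, ⟨h01, h02, -⟩, ⟨h12, -⟩, -⟩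
    refine ⟨fun i => ?_, fun i j hij => ?_⟩
    · fin_cases i <;> assumption
    · fin_cases i <;> fin_cases j <;> 
        first | rfl | exact absurd hij ‹_› | exact absurd hij.symm ‹_›
  · rintro ⟨h, hinj⟩
    have h01 : f 0 ≠ f 1 := hinj.ne (by decide)
    have h02 : f 0 ≠ f 2 := hinj.ne (by decide)
    have h12 : f 1 ≠ f 2 := hinj.ne (by decide)
    have hneg (i) : f i ≠ -f i := ZMod.ne_neg_self hodd (h i)
    have n01 : f 0 ≠ -f 1 := fun e => h 2 (by linear_combination hs - e)
    have n02 : f 0 ≠ -f 2 := fun e => h 1 (by linear_combination hs - e)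
    have n12 : f 1 ≠ -f 2 := fun e => h 0 (by linear_combination hs - e)
    have n10 : f 1 ≠ -f 0 := fun e => h 2 (by linear_combination hs - e)
    have n20 : f 2 ≠ -f 0 := fun e => h 1 (by linear_combination hs - e)
    have n21 : f 2 ≠ -f 1 := fun e => h 0 (by linear_combination hs - e)
    exact ⟨⟨h 0, h 1, h 2, h 0, h 1, h 2⟩, ⟨h01, h02, hneg 0, n01, n02⟩,
      ⟨h12, n10, hneg 1, n12⟩, ⟨n20, n21, hneg 2⟩, ⟨h01, h02⟩, h12⟩

theorem injective_of_generic {x : Fin 3 → ZMod v} (h : Generic (cycDiff x)) :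
    Function.Injective x := by
  have h0 : x 1 - x 2 ≠ 0 := h.1 0
  have h1 : x 2 - x 0 ≠ 0 := h.1 1
  have h2 : x 0 - x 1 ≠ 0 := h.1 2
  rw [sub_ne_zero] at h0 h1 h2
  intro i j hij
  fin_cases i <;> fin_cases j <;> first | rfl | (exfalso; simp at hij; grind)

theorem closure_eq_top_iff [NeZero v] (x : Fin 3 → ZMod v) :
    AddSubgroup.closure
        ((Finset.univ.image x - Finset.univ.image x : Finset (ZMod v)) : Set (ZMod v)) = ⊤ ↔
      ∃ c : Fin 3 → ZMod v, ∑ i, c i * cycDiff x i = 1 := by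
  constructor
  · intro h
    have h1 : (1 : ZMod v) ∈ AddSubgroup.closure
        ((Finset.univ.image x - Finset.univ.image x : Finset (ZMod v)) : Set (ZMod v)) :=
      h ▸ AddSubgroup.mem_top _
    generalize (1 : ZMod v) = s at h1
    induction h1 using AddSubgroup.closure_induction with
    | mem t ht =>
      rw [image_sub_image] at ht
      simp only [Finset.mem_coe, Multiset.mem_toFinset, Multiset.insert_eq_cons,
        Multiset.mem_cons, Multiset.mem_singleton] at ht
      simp only [Fin.sum_univ_three]
      rcases ht with rfl | rfl | rfl | rfl | rfl | rfl | rfl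
      · exact ⟨0, by simp⟩
      · exact ⟨![1, 0, 0], by simp⟩
      · exact ⟨![0, 1, 0], by simp⟩
      · exact ⟨![0, 0, 1], by simp⟩
      · exact ⟨![-1, 0, 0], by simp⟩
      · exact ⟨![0, -1, 0], by simp⟩
      · exact ⟨![0, 0, -1], by simp⟩
    | zero => exact ⟨0, by simp⟩
    | add s t _ _ hs ht =>
      obtain ⟨c, rfl⟩ := hs
      obtain ⟨d, rfl⟩ := ht
      exact ⟨c + d, by simp [add_mul, Finset.sum_add_distrib]⟩
    | neg t _ ht =>
      obtain ⟨c, rfl⟩ := ht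
      exact ⟨-c, by simp⟩
  · rintro ⟨c, hc⟩
    have h1 : (1 : ZMod v) ∈ AddSubgroup.closure
        ((Finset.univ.image x - Finset.univ.image x : Finset (ZMod v)) : Set (ZMod v)) := by
      rw [← hc]
      refine sum_mem fun i _ => ?_
      rw [← ZMod.natCast_zmod_val (c i), ← nsmul_eq_mul]
      refine nsmul_mem (AddSubgroup.subset_closure ?_) _
      exact Finset.mem_coe.2 (Finset.sub_mem_sub (Finset.mem_image_of_mem _ (Finset.mem_univ _))
        (Finset.mem_image_of_mem _ (Finset.mem_univ _)))
    refine (AddSubgroup.eq_top_iff' _).2 fun t => ?_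
    rw [← ZMod.natCast_zmod_val t, ← mul_one (t.val : ZMod v), ← nsmul_eq_mul]
    exact nsmul_mem h1 _

theorem image_mem_iff [NeZero v] (hodd : Odd v) (x : Fin 3 → ZMod v) :
    Finset.univ.image x ∈ Bcon3 v ↔
      Generic (cycDiff x) ∧ ∃ c : Fin 3 → ZMod v, ∑ i, c i * cycDiff x i = 1 := by
  have : Finset.univ.image x ∈ Bcon3 v ↔ (Finset.univ.image x).card = 3 ∧ _ ∧ _ := Iff.rfl
  rw [this, card_sub_iff hodd, closure_eq_top_iff]
  exact ⟨And.right, fun h => ⟨by rw [Finset.card_image_of_injective _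
    (injective_of_generic h.1), Finset.card_univ, Fintype.card_fin], h⟩⟩

theorem exists_enum (X : Bcon3 v) :
    ∃ x : Fin 3 → ZMod v, Function.Injective x ∧ Finset.univ.image x = X.1 := by
  have e := X.1.equivFinOfCardEq X.2.1
  refine ⟨fun i => e.symm i, Subtype.val_injective.comp e.symm.injective, ?_⟩
  ext t
  simp only [Finset.mem_image, Finset.mem_univ, true_and]
  exact ⟨by rintro ⟨i, rfl⟩; exact (e.symm i).2, fun h => ⟨e ⟨t, h⟩, by simp⟩⟩

/-- An enumeration of a base line. -/
noncomputable def enum (X : Bcon3 v) : Fin 3 → ZMod v := (exists_enum X).choose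

theorem enum_injective (X : Bcon3 v) : Function.Injective (enum X) := (exists_enum X).choose_spec.1

theorem image_enum (X : Bcon3 v) : Finset.univ.image (enum X) = X.1 :=
  (exists_enum X).choose_spec.2

/-- The difference triple of a base line. -/
noncomputable def triple [NeZero v] (X : Bcon3 v) : UnimodularTriple (ZMod v) :=
  ⟨cycDiff (enum X), sum_cycDiff _, (closure_eq_top_iff _).1 <| by
    rw [image_enum]; exact X.2.2.2⟩

theorem generic_triple [NeZero v] (hodd : Odd v) (X : Bcon3 v) : Generic (triple X).1 :=
  (card_sub_iff hodd _).1 (by rw [image_enum]; exact X.2.2.1)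

/-- The orbits of unimodular triples under scaling and permutation of coordinates. -/
abbrev TripleOrbits (v : ℕ) : Type :=
  MulAction.orbitRel.Quotient ((ZMod v)ˣ × Perm (Fin 3)) (UnimodularTriple (ZMod v))

theorem orbit_mk_eq_iff {f g : UnimodularTriple (ZMod v)} :
    (Quotient.mk _ f : TripleOrbits v) = Quotient.mk _ g ↔
      ∃ (u : (ZMod v)ˣ) (σ : Perm (Fin 3)), ∀ i, f.1 i = u * g.1 (σ i) := by
  rw [Quotient.eq]
  change f ∈ MulAction.orbit _ g ↔ _
  constructor
  · rintro ⟨⟨u, σ⟩, rfl⟩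
    exact ⟨u, σ⁻¹, fun i => rfl⟩
  · rintro ⟨u, σ, h⟩
    exact ⟨(u, σ⁻¹), Subtype.ext (funext fun i => by
      change u * g.1 (σ⁻¹⁻¹ i) = f.1 i
      rw [inv_inv, h])⟩

theorem orbit_eq_of_image_eq {f g : UnimodularTriple (ZMod v)} {x y : Fin 3 → ZMod v}
    (hf : cycDiff x = f.1) (hg : cycDiff y = g.1) (hy : Function.Injective y)
    (a : (ZMod v)ˣ) (b : ZMod v)
    (h : Finset.univ.image y = (Finset.univ.image x).image fun t => (a : ZMod v) * t + b) :
    (Quotient.mk _ f : TripleOrbits v) = Quotient.mk _ g := by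
  have (i : Fin 3) : ∃ j, a * x j + b = y i := by
    have : y i ∈ Finset.univ.image y := Finset.mem_image_of_mem _ (Finset.mem_univ i)
    simpa [h] using this
  choose s hs using this
  have hinj : Function.Injective s := fun i j hij => hy (by rw [← hs, ← hs, hij])
  let σ : Perm (Fin 3) := Equiv.ofBijective s (Finite.injective_iff_bijective.1 hinj)
  obtain ⟨ε, hε⟩ := exists_cycDiff_comp (v := v) σ
  refine Eq.symm (orbit_mk_eq_iff.2 ⟨a * ε, σ, fun i => ?_⟩)
  rw [← hf, ← hg, Units.val_mul, mul_assoc, ← hε]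
  change y (i + 1) - y (i + 2) = a * (x (s (i + 1)) - x (s (i + 2)))
  rw [← hs, ← hs]
  ring

theorem affRel3_of_orbit_eq [NeZero v] {X Y : Bcon3 v}
    (h : (Quotient.mk _ (triple Y) : TripleOrbits v) = Quotient.mk _ (triple X)) :
    affRel3 v X Y := by
  obtain ⟨u, σ, h⟩ := orbit_mk_eq_iff.1 h
  obtain ⟨ε, hε⟩ := exists_cycDiff_comp (v := v) σ
  have h' (i) : cycDiff (enum Y) i = (u * ε⁻¹ : (ZMod v)ˣ) * cycDiff (enum X ∘ σ) i := by
    rw [hε, ← mul_assoc, ← Units.val_mul, inv_mul_cancel_right]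
    exact h i
  obtain ⟨b, hb⟩ : ∃ b, ∀ i, enum Y i = (u * ε⁻¹ : (ZMod v)ˣ) * enum X (σ i) + b :=
    ⟨_, eq_add_of_cycDiff_eq h'⟩
  refine ⟨u * ε⁻¹, b, ?_⟩
  have hY : enum Y = ((fun t => ((u * ε⁻¹ : (ZMod v)ˣ) : ZMod v) * t + b) ∘ enum X) ∘ σ :=
    funext hb
  rw [← image_enum X, ← image_enum Y, hY, ← Finset.image_image, Finset.image_univ_equiv,
    Finset.image_image]

/-- The map sending the affine orbit of a base line to the orbit of its difference triple. -/
noncomputable def toTripleOrbit (v : ℕ) [NeZero v] : Quot (affRel3 v) → TripleOrbits v :=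
  Quot.lift (fun X => Quotient.mk _ (triple X)) fun X Y ⟨a, b, h⟩ =>
    orbit_eq_of_image_eq rfl rfl (enum_injective Y) a b (by rw [image_enum, image_enum, h])

theorem toTripleOrbit_injective [NeZero v] : Function.Injective (toTripleOrbit v) := by
  rintro ⟨X⟩ ⟨Y⟩ h
  exact Quot.sound (affRel3_of_orbit_eq h.symm)

theorem exists_triple_eq [NeZero v] (hodd : Odd v) {f : UnimodularTriple (ZMod v)}
    (hf : Generic f.1) : ∃ X : Bcon3 v, toTripleOrbit v (Quot.mk _ X) = Quotient.mk _ f := by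
  obtain ⟨x, hx⟩ := exists_cycDiff_eq f.sum_eq_zero
  let X : Bcon3 v := ⟨Finset.univ.image x, (image_mem_iff hodd x).2 (hx ▸ ⟨hf, f.2.2⟩)⟩
  exact ⟨X, orbit_eq_of_image_eq rfl hx (injective_of_generic (hx ▸ hf)) 1 0
    (by rw [image_enum]; simp [X])⟩

/-- The triple `(0, 1, -1)`. -/
def zeroTriple (v : ℕ) : UnimodularTriple (ZMod v) :=
  ⟨![0, 1, -1], by simp [Fin.sum_univ_three], ![0, 1, 0], by simp [Fin.sum_univ_three]⟩

/-- The triple `(-2, 1, 1)`. -/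
def doubleTriple (v : ℕ) : UnimodularTriple (ZMod v) :=
  ⟨![-2, 1, 1], by simp [Fin.sum_univ_three]; norm_num, ![0, 1, 0], by
    simp [Fin.sum_univ_three]⟩

theorem add_rotate (f : UnimodularTriple (ZMod v)) (k : Fin 3) :
    f.1 k + f.1 (k + 1) + f.1 (k + 2) = 0 := by
  have hs := f.apply_zero_add
  fin_cases k
  · exact hs
  · change f.1 1 + f.1 2 + f.1 0 = 0
    linear_combination hs
  · change f.1 2 + f.1 0 + f.1 1 = 0
    linear_combination hs

theorem eq_rotate (k i : Fin 3) : i = k ∨ i = k + 1 ∨ i = k + 2 := by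
  revert k i; decide

theorem orbit_eq_of_rotate {f g : UnimodularTriple (ZMod v)} {k : Fin 3} (u : (ZMod v)ˣ)
    (h0 : f.1 k = u * g.1 0) (h1 : f.1 (k + 1) = u * g.1 1) :
    (Quotient.mk _ f : TripleOrbits v) = Quotient.mk _ g := by
  refine orbit_mk_eq_iff.2 ⟨u, Equiv.subRight k, fun i => ?_⟩
  rw [Equiv.subRight_apply]
  rcases eq_rotate k i with rfl | rfl | rfl
  · rw [sub_self, h0]
  · rw [add_sub_cancel_left, h1]
  · rw [add_sub_cancel_left]
    linear_combination add_rotate f k - h0 - h1 - u * g.apply_zero_add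

theorem orbit_eq_zeroTriple {f : UnimodularTriple (ZMod v)} {k : Fin 3} (h : f.1 k = 0) :
    (Quotient.mk _ f : TripleOrbits v) = Quotient.mk _ (zeroTriple v) := by
  have hu : IsUnit (f.1 (k + 1)) := f.isUnit_of_forall_dvd fun i => by
    rcases eq_rotate k i with rfl | rfl | rfl
    · rw [h]; exact dvd_zero _
    · exact dvd_rfl
    · exact ⟨-1, by linear_combination add_rotate f k - h⟩
  exact orbit_eq_of_rotate hu.unit (k := k) (by simp [h, zeroTriple]) (by simp [zeroTriple])

theorem orbit_eq_doubleTriple {f : UnimodularTriple (ZMod v)} {k : Fin 3}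
    (h : f.1 (k + 1) = f.1 (k + 2)) :
    (Quotient.mk _ f : TripleOrbits v) = Quotient.mk _ (doubleTriple v) := by
  have hk : f.1 k = f.1 (k + 1) * -2 := by linear_combination add_rotate f k + h
  have hu : IsUnit (f.1 (k + 1)) := f.isUnit_of_forall_dvd fun i => by
    rcases eq_rotate k i with rfl | rfl | rfl
    · exact ⟨-2, hk⟩
    · exact dvd_rfl
    · exact h ▸ dvd_rfl
  exact orbit_eq_of_rotate hu.unit (k := k) (by simp [hk, doubleTriple]) (by simp [doubleTriple])

theorem orbit_zeroTriple_ne (hv : 4 < v) :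
    (Quotient.mk _ (zeroTriple v) : TripleOrbits v) ≠ Quotient.mk _ (doubleTriple v) := by
  intro h
  obtain ⟨u, σ, hu⟩ := orbit_mk_eq_iff.1 h
  have h0 : (doubleTriple v).1 (σ 0) = 0 := u.isUnit.mul_right_eq_zero.1 (hu 0).symm
  have hne {n : ℕ} (h1 : 0 < n) (h2 : n < 3) : ((n : ℕ) : ZMod v) ≠ 0 := by
    rw [Ne, ZMod.natCast_eq_zero_iff]
    exact fun hd => absurd (Nat.le_of_dvd h1 hd) (by omega)
  generalize σ 0 = j at h0
  fin_cases j
  · exact hne (n := 2) (by decide) (by decide) (by simpa [doubleTriple] using h0)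
  · exact hne (n := 1) (by decide) (by decide) (by simpa [doubleTriple] using h0)
  · exact hne (n := 1) (by decide) (by decide) (by simpa [doubleTriple] using h0)

theorem range_toTripleOrbit [NeZero v] (hodd : Odd v) :
    (Set.range (toTripleOrbit v))ᶜ =
      {Quotient.mk _ (zeroTriple v), Quotient.mk _ (doubleTriple v)} := by
  ext q
  induction q using Quotient.inductionOn with | _ f
  rw [Set.mem_compl_iff, Set.mem_insert_iff, Set.mem_singleton_iff]
  constructor
  · contrapose!
    rintro ⟨h0, h1⟩
    obtain ⟨X, hX⟩ := exists_triple_eq hodd (f := f)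
      ⟨fun i hi => h0 (orbit_eq_zeroTriple hi), fun i j hij => by
        by_contra hne
        have key : ∀ i j : Fin 3, i ≠ j →
            ∃ k, k + 1 = i ∧ k + 2 = j ∨ k + 1 = j ∧ k + 2 = i := by decide
        obtain ⟨k, ⟨rfl, rfl⟩ | ⟨rfl, rfl⟩⟩ := key i j hne
        · exact h1 (orbit_eq_doubleTriple hij)
        · exact h1 (orbit_eq_doubleTriple hij.symm)⟩
    exact ⟨_, hX⟩
  · rintro h ⟨⟨X⟩, hX⟩
    have hg := generic_triple hodd X
    rcases h with h | h
    · obtain ⟨u, σ, hu⟩ := orbit_mk_eq_iff.1 (hX.trans h)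
      refine hg.1 (σ.symm 0) ?_
      rw [hu, σ.apply_symm_apply]
      exact mul_zero _
    · obtain ⟨u, σ, hu⟩ := orbit_mk_eq_iff.1 (hX.trans h)
      have : σ.symm 1 = σ.symm 2 := hg.2 (by
        rw [hu, hu, σ.apply_symm_apply, σ.apply_symm_apply]; rfl)
      exact absurd (σ.symm.injective this) (by decide)

theorem numOrbits3_add_two (hv : 4 < v) (hodd : Odd v) :
    numOrbits3 v + 2 = Nat.card (TripleOrbits v) := by
  have : NeZero v := ⟨by omega⟩
  have : Finite (TripleOrbits v) := Quotient.finite _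
  rw [← Set.ncard_add_ncard_compl (Set.range (toTripleOrbit v)), range_toTripleOrbit hodd,
    Set.ncard_pair (orbit_zeroTriple_ne hv), ← Nat.card_coe_set_eq,
    Nat.card_range_of_injective toTripleOrbit_injective, numOrbits3]

end Bcon3

/-- for odd `v > 4` such that `9 ∣ v` or some prime divisor of `v`
is `≡ 2 (mod 3)`, the number of isomorphism classes of connected cyclic configurations
of type (v₃) is `(1/6)·v·∏(1 + 1/pᵢ) + (1/2)·2^k - 2`. -/
theorem numOrbits3_odd_remaining_case
    (v : ℕ) (hv : 4 < v) (hodd : Odd v)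
    (hcase : 9 ∣ v ∨ ∃ p ∈ v.primeFactors, p % 3 = 2) :
    (numOrbits3 v : ℚ) =
      (v : ℚ) / 6 * (∏ p ∈ v.primeFactors, (1 + 1 / (p : ℚ)))
        + 1 / 2 * 2 ^ v.primeFactors.card - 2 := by
  have : NeZero v := ⟨by omega⟩
  have hφ : (v.totient : ℚ) ≠ 0 := by
    exact_mod_cast (Nat.totient_pos.2 (by omega)).ne'
  have B := UnimodularTriple.card_orbits_mul (R := ZMod v)
    fun u => ZMod.one_add_add_sq_ne_zero hcase u
  rw [← Bcon3.numOrbits3_add_two hv hodd, ZMod.card_sq_eq_one hodd,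
    Nat.card_congr (UnimodularTriple.equivCoprimePairs _), Nat.card_eq_fintype_card (α := (ZMod v)ˣ),
    ZMod.card_units_eq_totient] at B
  have hB := congrArg (Nat.cast : ℕ → ℚ) B
  push_cast at hB
  rw [ZMod.card_coprimePairs (by omega)] at hB
  apply mul_left_cancel₀ hφ
  linear_combination hB / 6
end

section
/- Let v = pq where p and q are distinct primes, let k ≥ 3, and for r = 1, 2 let S_r ⊆ Z_v satisfy |S_r| = k and |S_r − S_r| = k² − k + 1 (so that S_r is a base line of a balanced cyclic configuration of type (v_k)). Then the configurations Conf(Z_v, S₁) and Conf(Z_v, S₂) are isomorphic if and only if they are multiplier equivalent, i.e., if and only if there exist a unit a ∈ Z_v* and b ∈ Z_v such that S₁ = aS₂ + b. -/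
open scoped Pointwise

/-- The line set of the cyclic configuration `Conf(Z_v, S)`: the translates `S + i`. -/
def confLines (v : ℕ) (S : Finset (ZMod v)) : Set (Finset (ZMod v)) :=
  {B | ∃ i : ZMod v, B = S.image (· + i)}

/-- Two cyclic configurations are isomorphic if some bijection of `ZMod v` maps the
line set of the first onto the line set of the second. -/
def ConfIso (v : ℕ) (S₁ S₂ : Finset (ZMod v)) : Prop :=
  ∃ σ : Equiv.Perm (ZMod v),
    (fun B : Finset (ZMod v) => B.image σ) '' confLines v S₁ = confLines v S₂

/-- Multiplier equivalence: `S₁ = a S₂ + b` for a unit `a` and some `b`. -/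
def MultEquiv (v : ℕ) (S₁ S₂ : Finset (ZMod v)) : Prop :=
  ∃ a : (ZMod v)ˣ, ∃ b : ZMod v, S₁ = S₂.image (fun x => (a : ZMod v) * x + b)

theorem Subgroup.exists_conj_mem_isPGroup {M : Type*} [Group M] [Finite M] (p : ℕ) [Fact p.Prime]
    (G : Subgroup M) {x y : M} (hx : x ∈ G) (hy : y ∈ G) (hxp : x ^ p = 1) (hyp : y ^ p = 1) :
    ∃ g ∈ G, ∃ K ≤ G, IsPGroup p K ∧ x ∈ K ∧ g * y * g⁻¹ ∈ K := by
  have key : ∀ z : G, z ^ p = 1 → ∃ P : Sylow p G, z ∈ P := fun z hz => by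
    have : IsPGroup p (Subgroup.zpowers z) := by
      rintro ⟨w, n, rfl⟩
      refine ⟨1, Subtype.ext ?_⟩
      change (z ^ n) ^ p ^ 1 = 1
      rw [pow_one, ← zpow_natCast, zpow_comm, zpow_natCast, hz, one_zpow]
    obtain ⟨P, hP⟩ := this.exists_le_sylow
    exact ⟨P, hP (Subgroup.mem_zpowers z)⟩
  obtain ⟨P, hP⟩ := key ⟨x, hx⟩ (Subtype.ext hxp)
  obtain ⟨Q, hQ⟩ := key ⟨y, hy⟩ (Subtype.ext hyp)
  obtain ⟨g, hg⟩ := MulAction.exists_smul_eq G Q P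
  refine ⟨g, g.2, P.map G.subtype, Subgroup.map_subtype_le _, P.isPGroup'.map _,
    ⟨⟨x, hx⟩, hP, rfl⟩, ⟨g * ⟨y, hy⟩ * g⁻¹, ?_, rfl⟩⟩
  rw [← hg]
  exact ⟨⟨y, hy⟩, hQ, rfl⟩

/-- Let a `p`-group act on a set consisting of fewer than `p` cyclically arranged blocks of size `p`,
some element `t` rotating each block by one step. Then every element rotates each block. -/
theorem IsPGroup.exists_smul_eq_shift {p : ℕ} [Fact p.Prime] {K X ι : Type*} [Group K] [Finite K]
    [MulAction K X] [Finite ι] (hK : IsPGroup p K) (hι : Nat.card ι < p)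
    {e : ZMod p × ι → X} (he : Function.Injective e) (hmaps : ∀ (f : K) v, ∃ w, f • e v = e w)
    {t : K} (ht : ∀ x i, t • e (x, i) = e (x + 1, i)) (f : K) (i : ι) :
    ∃ c, ∀ x, f • e (x, i) = e (x + c, i) := by
  have hp : p.Prime := Fact.out
  have htn : ∀ (n : ℕ) x, t ^ n • e (x, i) = e (x + n, i) := fun n => by
    induction n with
    | zero => simp
    | succ n ih => intro x; rw [pow_succ', mul_smul, ih, ht, Nat.cast_succ, add_assoc]
  have htx : ∀ x y : ZMod p, t ^ y.val • e (x, i) = e (x + y, i) := fun x y => by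
    rw [htn, ZMod.natCast_zmod_val]
  set O := MulAction.orbit K (e (0, i)) with hO
  have hsub : Set.range (fun x : ZMod p => e (x, i)) ⊆ O := by
    rintro _ ⟨x, rfl⟩
    exact ⟨t ^ x.val, by simpa using htx 0 x⟩
  have hOr : O ⊆ Set.range e := by
    rintro _ ⟨g, rfl⟩
    obtain ⟨w, hw⟩ := hmaps g (0, i)
    exact ⟨w, hw.symm⟩
  have hcr : (Set.range (fun x : ZMod p => e (x, i))).ncard = p := by
    rw [← Set.image_univ, Set.ncard_image_of_injective _ fun x y h => by simpa using he h]
    simp [Set.ncard_univ]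
  have hfin : O.Finite := (Set.finite_range e).subset hOr
  have hle : O.ncard ≤ p * Nat.card ι := by
    refine (Set.ncard_le_ncard hOr (Set.finite_range e)).trans ?_
    rw [← Set.image_univ, Set.ncard_image_of_injective _ he]
    simp [Set.ncard_univ, Nat.card_prod]
  have hge := Set.ncard_le_ncard hsub hfin
  rw [hcr] at hge
  have hcard : O.ncard = p := by
    have : Finite O := hfin
    obtain ⟨n, hn⟩ := hK.card_orbit (e (0, i))
    change O.ncard = p ^ n at hn
    have h2 : p ^ n < p ^ 2 := by
      rw [← hn, sq]
      exact hle.trans_lt (Nat.mul_lt_mul_of_pos_left hι hp.pos)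
    have h1 : n < 2 := (Nat.pow_lt_pow_iff_right hp.one_lt).1 h2
    have := hp.one_lt
    interval_cases n
    · rw [pow_zero] at hn; omega
    · rw [hn, pow_one]
  have hOeq := Set.eq_of_subset_of_ncard_le hsub (by rw [hcr, hcard]) hfin
  have hidx : (MulAction.stabilizer K (e (0, i))).index = p := by
    rw [MulAction.index_stabilizer, hcard]
  have hnormal : (MulAction.stabilizer K (e (0, i))).Normal := by
    apply Subgroup.normal_of_index_eq_minFac_card
    rw [hidx]
    obtain ⟨n, hn⟩ := hK.exists_card_eq
    have hn0 : n ≠ 0 := by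
      rintro rfl
      have := Subgroup.index_dvd_card (MulAction.stabilizer K (e (0, i)))
      rw [hidx, hn, pow_zero, Nat.dvd_one] at this
      exact hp.one_lt.ne' this
    rw [hn, hp.pow_minFac hn0]
  have hf : f • e (0, i) ∈ O := ⟨f, rfl⟩
  rw [← hOeq] at hf
  obtain ⟨c, hc⟩ := hf
  refine ⟨c, fun x => ?_⟩
  have hmem : (t ^ c.val)⁻¹ * f ∈ MulAction.stabilizer K (e (0, i)) := by
    rw [MulAction.mem_stabilizer_iff, mul_smul, ← hc, inv_smul_eq_iff, htx, zero_add]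
  have := hnormal.conj_mem _ hmem (t ^ x.val)⁻¹
  rw [MulAction.mem_stabilizer_iff, inv_inv, mul_smul, mul_smul, htx, inv_smul_eq_iff, htx,
    zero_add, mul_smul, inv_smul_eq_iff, htx] at this
  exact this

/-- The set of translates of `S` in an arbitrary additive group. -/
def translates {A : Type*} [DecidableEq A] [Add A] (S : Finset A) : Set (Finset A) :=
  {B | ∃ i : A, B = S.image (· + i)}

/-- Every nonzero element of `A` is a difference of elements of `S` in at most one way. -/
def UniqueDiffs {A : Type*} [Sub A] (S : Finset A) : Prop :=
  ∀ a ∈ S, ∀ b ∈ S, ∀ c ∈ S, ∀ d ∈ S, a ≠ b → a - b = c - d → a = c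

theorem uniqueDiffs_of_card_sub {A : Type*} [DecidableEq A] [AddGroup A] {S : Finset A}
    (h : (S - S).card = S.card ^ 2 - S.card + 1) : UniqueDiffs S := by
  have hsub : S - S ⊆ insert 0 (S.offDiag.image fun x => x.1 - x.2) := by
    intro x hx
    obtain ⟨a, ha, b, hb, rfl⟩ := Finset.mem_sub.1 hx
    by_cases hab : a = b
    · simp [hab]
    · exact Finset.mem_insert_of_mem
        (Finset.mem_image.2 ⟨(a, b), Finset.mem_offDiag.2 ⟨ha, hb, hab⟩, rfl⟩)
  have h1 := (Finset.card_le_card hsub).trans (Finset.card_insert_le _ _)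
  have h2 := Finset.card_image_le (s := S.offDiag) (f := fun x => x.1 - x.2)
  have h3 : (S.offDiag.image fun x => x.1 - x.2).card = S.offDiag.card := by
    rw [Finset.offDiag_card, ← sq] at *
    omega
  have hinj := Finset.card_image_iff.1 h3
  intro a ha b hb c hc d hd hab habcd
  have hcd : c ≠ d := fun hcd => hab (sub_eq_zero.1 (by rw [habcd, hcd, sub_self]))
  have := @hinj (a, b) (by simp [ha, hb, hab]) (c, d) (by simp [hc, hd, hcd]) habcd
  exact congrArg Prod.fst this

section translates

variable {A : Type*} [DecidableEq A] [AddCommGroup A]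

theorem mem_image_add_right {S : Finset A} {i x : A} : x ∈ S.image (· + i) ↔ x - i ∈ S := by
  simp [sub_eq_add_neg]

theorem UniqueDiffs.image_add_right_injective {S : Finset A} (hS : UniqueDiffs S)
    (hcard : S.Nontrivial) : Function.Injective fun i => S.image (· + i) := by
  intro i j hij
  obtain ⟨s, hs, t, ht, hst⟩ := hcard
  have key : ∀ x ∈ S, x + (i - j) ∈ S := fun x hx => by
    have : x + i ∈ S.image (· + j) := by
      rw [← show S.image (· + i) = S.image (· + j) from hij]
      exact Finset.mem_image_of_mem _ hx
    rwa [mem_image_add_right, add_sub_assoc] at this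
  by_contra hne
  have hne : i - j ≠ 0 := sub_ne_zero.2 hne
  exact hst (add_right_cancel
    (hS _ (key s hs) _ hs _ (key t ht) _ ht (by simpa using hne) (by abel)))

theorem addRight_smul_image (u i : A) (S : Finset A) :
    (Equiv.addRight u : Equiv.Perm A) • S.image (· + i) = S.image (· + (i + u)) := by
  rw [Finset.smul_finset_def, Finset.image_image]
  exact Finset.image_congr fun x _ => add_assoc x i u

theorem addRight_mem_stabilizer (u : A) (S : Finset A) :
    (Equiv.addRight u : Equiv.Perm A) ∈
      MulAction.stabilizer (Equiv.Perm A) (translates S) := by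
  rw [MulAction.mem_stabilizer_iff]
  ext B
  constructor
  · rintro ⟨_, ⟨i, rfl⟩, rfl⟩
    exact ⟨i + u, addRight_smul_image u i S⟩
  · rintro ⟨i, rfl⟩
    exact ⟨S.image (· + (i - u)), ⟨_, rfl⟩,
      (addRight_smul_image u (i - u) S).trans (by rw [sub_add_cancel])⟩

theorem conj_mem_stabilizer_of_smul_eq {G X : Type*} [Group G] [MulAction G X] {σ g : G} {x y : X}
    (hσ : σ • x = y) (hg : g ∈ MulAction.stabilizer G x) :
    σ * g * σ⁻¹ ∈ MulAction.stabilizer G y := by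
  rw [MulAction.mem_stabilizer_iff] at *
  rw [← hσ, mul_smul, mul_smul, inv_smul_smul, hg]

theorem exists_sub_mem_iff_of_smul_eq {S T : Finset A} {σ : Equiv.Perm A}
    (h : σ • translates S = translates T) : ∃ j, ∀ x, x ∈ S ↔ σ x - j ∈ T := by
  have : σ • S ∈ translates T := by
    rw [← h]
    exact Set.smul_mem_smul_set ⟨0, by simp⟩
  obtain ⟨j, hj⟩ := this
  refine ⟨j, fun x => ?_⟩
  rw [← mem_image_add_right, ← hj]
  exact (Finset.smul_mem_smul_finset_iff σ).symm

end translates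

section product

variable {p q : ℕ} [Fact p.Prime] [Fact q.Prime]

theorem perm_apply_of_conj_shift {σ : Equiv.Perm (ZMod p × ZMod q)} {c : ZMod q → ZMod p}
    (hf : ∀ i x,
      (σ * (Equiv.addRight (1, 0) : Equiv.Perm (ZMod p × ZMod q)) * σ⁻¹) (x, i) = (x + c i, i)) (x : ZMod p)
    (i : ZMod q) : σ (x, i) = ((σ (0, i)).1 + x * c (σ (0, i)).2, (σ (0, i)).2) := by
  have step : ∀ x, σ (x + 1, i) = ((σ (x, i)).1 + c (σ (x, i)).2, (σ (x, i)).2) := fun x => by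
    rw [← hf]
    simp
  have : ∀ n : ℕ, σ (n, i) = ((σ (0, i)).1 + n * c (σ (0, i)).2, (σ (0, i)).2) := fun n => by
    induction n with
    | zero => simp
    | succ n ih =>
      rw [Nat.cast_succ, step, ih]
      ext <;> simp
      ring
  simpa using this x.val

theorem eq_zero_of_forall_shift_mem {S : Finset (ZMod p × ZMod q)} (hS : UniqueDiffs S)
    {i : ZMod q} {e x₀ : ZMod p} (hx₀ : (x₀, i) ∈ S)
    (h : ∀ x, (x, i) ∈ S → (x + e, i) ∈ S) : e = 0 := by
  by_contra he
  have h1 := h _ hx₀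
  have := hS _ h1 _ hx₀ _ (h _ h1) _ h1 (by simpa using he) (by ext <;> simp)
  simp [he] at this

theorem eq_const_of_forall_add_eq {α : Type*} {c : ZMod q → α} {δ : ZMod q} (hδ : δ ≠ 0)
    (h : ∀ i, c (i + δ) = c i) (i : ZMod q) : c i = c 0 := by
  have : ∀ n : ℕ, c (n * δ) = c 0 := fun n => by
    induction n with
    | zero => simp
    | succ n ih => rw [Nat.cast_succ, add_one_mul, h, ih]
  simpa [hδ] using this (i / δ).val

/-- The case of a disconnected configuration, whose lines lie in single fibres of the second
projection. -/
theorem exists_affine_of_snd_const {S₁ S₂ : Finset (ZMod p × ZMod q)}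
    {σ : Equiv.Perm (ZMod p × ZMod q)} (hσ : σ • translates S₁ = translates S₂)
    {c : ZMod q → ZMod p}
    (hf : ∀ i x,
      (σ * (Equiv.addRight (1, 0) : Equiv.Perm (ZMod p × ZMod q)) * σ⁻¹) (x, i) = (x + c i, i))
    (hne : S₂.Nonempty) {i₂ : ZMod q} (h₂ : ∀ s ∈ S₂, s.2 = i₂) :
    ∃ a b, a ≠ 0 ∧ b ≠ 0 ∧ ∃ w, ∀ x, x ∈ S₁ ↔ (a * x.1, b * x.2) + w ∈ S₂ := by
  obtain ⟨j, hj⟩ := exists_sub_mem_iff_of_smul_eq hσ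
  have hform := perm_apply_of_conj_shift hf
  have hinj : Function.Injective fun i => (σ (0, i)).2 := by
    rw [Finite.injective_iff_surjective]
    intro i
    obtain ⟨⟨x, k⟩, hx⟩ := σ.surjective (0, i)
    refine ⟨k, ?_⟩
    rw [hform] at hx
    exact congrArg Prod.snd hx
  obtain ⟨s, hs⟩ := hne
  obtain ⟨⟨x₁, i₁⟩, hx₁⟩ : ∃ x, x ∈ S₁ :=
    ⟨σ⁻¹ (s + j), by rw [hj]; simpa using hs⟩
  have hi₁ : (σ (0, i₁)).2 - j.2 = i₂ := by
    have := h₂ _ ((hj _).1 hx₁)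
    rw [hform] at this
    exact this
  refine ⟨c (σ (0, i₁)).2, 1, fun h0 => ?_, one_ne_zero,
    ((σ (0, i₁)).1 - j.1, (σ (0, i₁)).2 - j.2 - i₁), ?_⟩
  · have h1 := hform 1 i₁
    rw [h0, mul_zero, add_zero] at h1
    have := σ.injective (show σ (1, i₁) = σ (0, i₁) from h1)
    simp at this
  · rintro ⟨x, i⟩
    have heq : i = i₁ → σ (x, i) - j = (c (σ (0, i₁)).2 * (x, i).1, 1 * (x, i).2) +
        ((σ (0, i₁)).1 - j.1, (σ (0, i₁)).2 - j.2 - i₁) := by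
      rintro rfl
      rw [hform]
      ext
      · simp; ring
      · simp
    constructor
    · intro hx
      have h1 := (hj _).1 hx
      have h2 := h₂ _ h1
      rw [hform] at h2
      have hi : i = i₁ := hinj (sub_left_injective (h2.trans hi₁.symm))
      rwa [heq hi] at h1
    · intro hx
      have h2 := h₂ _ hx
      have hi : i = i₁ := by
        have : 1 * i + ((σ (0, i₁)).2 - j.2 - i₁) = i₂ := h2
        rw [hi₁] at this
        linear_combination this
      rw [hj, heq hi]
      exact hx

/-- If `S` meets two different fibres of the second projection, then an element of a `p`-group of
automorphisms containing the shift by `(1, 0)` shifts all fibres by the same amount. -/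
theorem shift_const_of_mem_isPGroup (hqp : q < p) {S : Finset (ZMod p × ZMod q)}
    (hS : UniqueDiffs S) {s t : ZMod p × ZMod q} (hs : s ∈ S) (ht : t ∈ S) (hst : s.2 ≠ t.2)
    {K : Subgroup (Equiv.Perm (ZMod p × ZMod q))} (hK : IsPGroup p K)
    (hKS : K ≤ MulAction.stabilizer _ (translates S)) (hτ : Equiv.addRight (1, 0) ∈ K)
    {f : Equiv.Perm (ZMod p × ZMod q)} (hfK : f ∈ K) {c : ZMod q → ZMod p}
    (hf : ∀ i x, f (x, i) = (x + c i, i)) (i : ZMod q) : c i = c 0 := by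
  have hSn : S.Nontrivial := ⟨s, hs, t, ht, fun h => hst (h ▸ rfl)⟩
  have hline : ∀ j : ZMod q, ∃ d, ∀ x,
      (⟨f, hfK⟩ : K) • S.image (· + (x, j)) = S.image (· + (x + d, j)) := fun j =>
    hK.exists_smul_eq_shift (by simpa using hqp) (hS.image_add_right_injective hSn)
      (fun g v => by
        have : (g : Equiv.Perm (ZMod p × ZMod q)) • S.image (· + v) ∈ translates S := by
          rw [← MulAction.mem_stabilizer_iff.1 (hKS g.2)]
          exact Set.smul_mem_smul_set ⟨v, rfl⟩
        exact this) (t := ⟨_, hτ⟩)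
      (fun x i => (addRight_smul_image (1, 0) (x, i) S).trans (by simp)) ⟨f, hfK⟩ j
  choose d hd using hline
  have key : ∀ s ∈ S, ∀ j, c (s.2 + j) = d j := by
    rintro ⟨x₀, i⟩ hs j
    rw [← sub_eq_zero]
    refine eq_zero_of_forall_shift_mem hS hs fun x hx => ?_
    have h1 : f • ((x, i) + (0, j)) ∈ f • S.image (· + ((0 : ZMod p), j)) :=
      Finset.smul_mem_smul_finset (Finset.mem_image_of_mem _ hx)
    rw [show f • S.image (· + ((0 : ZMod p), j)) = _ from hd j 0, mem_image_add_right] at h1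
    rw [Equiv.Perm.smul_def, Prod.mk_add_mk, hf] at h1
    convert h1 using 1
    ext <;> simp
    ring
  refine eq_const_of_forall_add_eq (sub_ne_zero.2 hst) (fun i => ?_) i
  rw [show i + (s.2 - t.2) = s.2 + (i - t.2) by ring, key s hs, ← key t ht]
  ring_nf

/-- A `q`-group of permutations which contains the shift by `(0, 1)` and commutes with the shifts of
the first coordinate consists of shifts of the second coordinate. -/
theorem exists_eq_snd_shift_of_mem_isPGroup (hqp : q < p)
    {K : Subgroup (Equiv.Perm (ZMod p × ZMod q))} (hK : IsPGroup q K)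
    (hρ : Equiv.addRight (0, 1) ∈ K) {a : ZMod p} (ha : a ≠ 0)
    (hcomm : ∀ g ∈ K, ∀ v, g (v + (a, 0)) = g v + (a, 0))
    {g : Equiv.Perm (ZMod p × ZMod q)} (hg : g ∈ K) : ∃ m, ∀ v, g v = v + (0, m) := by
  have hcomm' : ∀ g ∈ K, ∀ x i, g (x, i) = g (0, i) + (x, 0) := fun g hg x i => by
    have : ∀ n : ℕ, g (n * a, i) = g (0, i) + (n * a, 0) := fun n => by
      induction n with
      | zero => simp
      | succ n ih =>
        have h1 := hcomm g hg (n * a, i)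
        rw [ih] at h1
        simpa [add_one_mul, add_assoc] using h1
    simpa [ha] using this (x / a).val
  have hblock : ∀ g ∈ K, ∀ i, g • {v : ZMod p × ZMod q | v.2 = i} = {v | v.2 = (g (0, i)).2} := by
    intro g hg i
    ext w
    constructor
    · rintro ⟨⟨x, k⟩, rfl : k = i, rfl⟩
      change (g (x, k)).2 = _
      simp [hcomm' g hg x k]
    · intro hw
      refine ⟨(w.1 - (g (0, i)).1, i), rfl, ?_⟩
      change g _ = w
      rw [hcomm' g hg]
      ext
      · simp
      · simpa using hw.symm
  obtain ⟨m, hm⟩ := hK.exists_smul_eq_shift (ι := Unit) (X := Set (ZMod p × ZMod q))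
    (by simpa using (Fact.out : q.Prime).one_lt) (e := fun i => {v | v.2 = i.1})
    (fun i j hij => by
      have : ((0 : ZMod p), i.1) ∈ {v : ZMod p × ZMod q | v.2 = j.1} := by
        rw [← show {v : ZMod p × ZMod q | v.2 = i.1} = {v | v.2 = j.1} from hij]
        rfl
      exact Prod.ext this rfl)
    (fun g v => ⟨((g.1 (0, v.1)).2, ()), hblock g g.2 v.1⟩) (t := ⟨_, hρ⟩)
    (fun x _ => (hblock _ hρ x).trans (by simp)) ⟨g, hg⟩ ()
  have hm' : ∀ i, (g (0, i)).2 = i + m := fun i => by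
    have h1 := (hblock g hg i).symm.trans (hm i)
    have : g (0, i) ∈ {v : ZMod p × ZMod q | v.2 = (g (0, i)).2} := rfl
    rwa [h1] at this
  set ρ : Equiv.Perm (ZMod p × ZMod q) := Equiv.addRight (0, 1)
  have hz : ρ ^ m.val = Equiv.addRight (0, m) := by simp [ρ]
  have hyK : (ρ ^ m.val)⁻¹ * g ∈ K := K.mul_mem (K.inv_mem (K.pow_mem hρ _)) hg
  rw [hz] at hyK
  generalize hy : (Equiv.addRight (0, m) : Equiv.Perm (ZMod p × ZMod q))⁻¹ * g = y at hyK
  have hgy : ∀ v, g v = y v + (0, m) := fun v => by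
    simp [← hy, add_assoc]
  have hyn : ∀ i, ∀ n : ℕ, (y ^ n) (0, i) = (n * (y (0, i)).1, i) := fun i n => by
    have hy2 : (y (0, i)).2 = i := by
      have := hm' i
      rw [hgy] at this
      simpa using this
    induction n with
    | zero => simp
    | succ n ih =>
      rw [pow_succ', Equiv.Perm.mul_apply, ih, hcomm' y hyK]
      ext
      · simp; ring
      · simpa using hy2
  obtain ⟨k, hk⟩ := hK ⟨y, hyK⟩
  replace hk : y ^ q ^ k = 1 := congrArg Subtype.val hk
  have hqk : ((q ^ k : ℕ) : ZMod p) ≠ 0 := by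
    rw [Ne, ZMod.natCast_eq_zero_iff]
    intro h
    exact hqp.ne' ((Nat.prime_dvd_prime_iff_eq Fact.out Fact.out).1
      ((Fact.out : p.Prime).dvd_of_dvd_pow h))
  refine ⟨m, fun v => ?_⟩
  have h0 : y (0, v.2) = (0, v.2) := by
    have h1 := hyn v.2 (q ^ k)
    rw [hk] at h1
    have h2 := congrArg Prod.fst h1
    have h3 := hyn v.2 1
    rw [pow_one] at h3
    rw [h3]
    rw [eq_comm] at h2
    simpa [hqk] using (mul_eq_zero.1 h2).resolve_left hqk
  rw [hgy, show v = (v.1, v.2) from rfl, hcomm' y hyK, h0]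
  simp

theorem exists_affine_of_smul_translates_eq (hqp : q < p) {S₁ S₂ : Finset (ZMod p × ZMod q)}
    (hS₂ : UniqueDiffs S₂) (hne : S₂.Nonempty)
    {σ : Equiv.Perm (ZMod p × ZMod q)} (hσ : σ • translates S₁ = translates S₂) :
    ∃ a b, a ≠ 0 ∧ b ≠ 0 ∧ ∃ w, ∀ x, x ∈ S₁ ↔ (a * x.1, b * x.2) + w ∈ S₂ := by
  set τ : Equiv.Perm (ZMod p × ZMod q) := Equiv.addRight (1, 0) with hτ
  set ρ : Equiv.Perm (ZMod p × ZMod q) := Equiv.addRight (0, 1) with hρ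
  set G := MulAction.stabilizer (Equiv.Perm (ZMod p × ZMod q)) (translates S₂) with hG
  have hτp : τ ^ p = 1 := by ext1; simp [hτ]
  have hρq : ρ ^ q = 1 := by ext1; simp [hρ]
  obtain ⟨g, hg, K, hKG, hK, hτK, hfK⟩ := G.exists_conj_mem_isPGroup p
    (addRight_mem_stabilizer (1, 0) S₂)
    (conj_mem_stabilizer_of_smul_eq hσ (addRight_mem_stabilizer (1, 0) S₁)) hτp
    (by rw [conj_pow, hτp, mul_one, mul_inv_cancel])
  replace hσ : (g * σ) • translates S₁ = translates S₂ := by rw [mul_smul, hσ, hg]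
  rw [← hτ, show g * (σ * τ * σ⁻¹) * g⁻¹ = (g * σ) * τ * (g * σ)⁻¹ by group] at hfK
  generalize g * σ = σ at hσ hfK
  have hf : ∀ i, ∃ c, ∀ x, (σ * τ * σ⁻¹) (x, i) = (x + c, i) := fun i =>
    hK.exists_smul_eq_shift (by simpa using hqp) Function.injective_id (fun f v => ⟨_, rfl⟩)
      (t := ⟨τ, hτK⟩) (fun x i => by simp [hτ]) ⟨_, hfK⟩ i
  choose c hc using hf
  by_cases hsnd : ∃ s ∈ S₂, ∃ t ∈ S₂, s.2 ≠ t.2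
  swap
  · push Not at hsnd
    obtain ⟨s, hs⟩ := hne
    exact exists_affine_of_snd_const hσ hc ⟨s, hs⟩ fun t ht => hsnd t ht s hs
  obtain ⟨s, hs, t, ht, hst⟩ := hsnd
  have hconst := shift_const_of_mem_isPGroup hqp hS₂ hs ht hst hK hKG hτK hfK hc
  generalize c 0 = a at hconst
  have hfa : σ * τ * σ⁻¹ = Equiv.addRight (a, 0) := by
    ext1 ⟨x, i⟩
    rw [hc, hconst]
    simp
  have ha : a ≠ 0 := by
    rintro rfl
    have h1 : σ * τ * σ⁻¹ = 1 := by rw [hfa]; ext1; simp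
    have h2 : τ = 1 := by simpa using h1
    simpa [hτ] using congrArg (fun g : Equiv.Perm (ZMod p × ZMod q) => g 0) h2
  have hcommτρ : τ * ρ = ρ * τ := by ext1; simp [hτ, hρ, add_right_comm]
  obtain ⟨h, hh, K', hK'H, hK', hρK', hyK'⟩ :=
    (G ⊓ Subgroup.centralizer {σ * τ * σ⁻¹}).exists_conj_mem_isPGroup q (x := ρ)
      (y := σ * ρ * σ⁻¹)
    ⟨addRight_mem_stabilizer (0, 1) S₂, Subgroup.mem_centralizer_singleton_iff.2 (by
      rw [hfa]; ext1; simp [hρ, add_right_comm])⟩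
    ⟨conj_mem_stabilizer_of_smul_eq hσ (addRight_mem_stabilizer (0, 1) S₁),
      Subgroup.mem_centralizer_singleton_iff.2 (by
        rw [conj_mul, conj_mul, hcommτρ])⟩ hρq
    (by rw [conj_pow, hρq, mul_one, mul_inv_cancel])
  replace hσ : (h * σ) • translates S₁ = translates S₂ := by rw [mul_smul, hσ, hh.1]
  have hhf := Subgroup.mem_centralizer_singleton_iff.1 hh.2
  rw [show h * (σ * ρ * σ⁻¹) * h⁻¹ = (h * σ) * ρ * (h * σ)⁻¹ by group] at hyK'
  have hfa' : (h * σ) * τ * (h * σ)⁻¹ = Equiv.addRight (a, 0) := by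
    rw [← hfa, show h * σ * τ * (h * σ)⁻¹ = h * (σ * τ * σ⁻¹) * h⁻¹ by group, hhf,
      mul_inv_cancel_right]
  rw [hfa] at hK'H
  generalize h * σ = σ at hσ hyK' hfa'
  obtain ⟨b, hb⟩ := exists_eq_snd_shift_of_mem_isPGroup hqp hK' hρK' ha (fun g hg v =>
    congrArg (fun f : Equiv.Perm (ZMod p × ZMod q) => f v)
      (Subgroup.mem_centralizer_singleton_iff.1 (hK'H hg).2)) hyK'
  have hσ1 : ∀ v, σ (v + (1, 0)) = σ v + (a, 0) := fun v => by
    have := congrArg (fun f : Equiv.Perm (ZMod p × ZMod q) => f (σ v)) hfa'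
    simpa [hτ] using this
  have hσ2 : ∀ v, σ (v + (0, 1)) = σ v + (0, b) := fun v => by
    simpa [hρ] using hb (σ v)
  have hb0 : b ≠ 0 := by
    rintro rfl
    have := σ.injective ((hσ2 0).trans (add_zero (σ 0)))
    simp at this
  have hσn : ∀ n m : ℕ, σ (n, m) = σ 0 + (a * n, b * m) := fun n m => by
    induction n with
    | zero =>
      induction m with
      | zero => simp [← Prod.zero_eq_mk]
      | succ m ih =>
        have := hσ2 (((0 : ℕ) : ZMod p), m)
        rw [ih] at this
        simpa [add_assoc, mul_add] using this
    | succ n ih =>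
      have := hσ1 (n, m)
      rw [ih] at this
      simpa [add_assoc, mul_add] using this
  obtain ⟨j, hj⟩ := exists_sub_mem_iff_of_smul_eq hσ
  refine ⟨a, b, ha, hb0, σ 0 - j, fun x => ?_⟩
  have := hσn x.1.val x.2.val
  simp only [ZMod.natCast_zmod_val] at this
  rw [hj, this, add_comm (σ 0), add_sub_assoc]

end product

section transfer

theorem UniqueDiffs.image {A B : Type*} [DecidableEq B] [AddGroup A] [AddGroup B] {S : Finset A} (hS : UniqueDiffs S)
    (e : A ≃+ B) : UniqueDiffs (S.image e) := by
  simp only [UniqueDiffs, Finset.forall_mem_image, ← map_sub, e.injective.eq_iff, e.injective.ne_iff]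
  exact hS

variable {A B : Type*} [DecidableEq A] [DecidableEq B]

theorem translates_image [Add A] [Add B] (S : Finset A) (e : A ≃+ B) :
    translates (S.image e) = (fun C => C.image e) '' translates S := by
  have key : ∀ i, (S.image (· + i)).image e = (S.image e).image (· + e i) := fun i => by
    simp [Finset.image_image, Function.comp_def]
  ext C
  constructor
  · rintro ⟨i, rfl⟩
    exact ⟨_, ⟨e.symm i, rfl⟩, by simp [key]⟩
  · rintro ⟨_, ⟨i, rfl⟩, rfl⟩
    exact ⟨e i, key i⟩

theorem permCongr_smul_translates_image [Add A] [Add B] {S T : Finset A} {σ : Equiv.Perm A}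
    (e : A ≃+ B) (h : σ • translates S = translates T) :
    e.toEquiv.permCongr σ • translates (S.image e) = translates (T.image e) := by
  rw [translates_image, translates_image, ← h]
  change (fun C : Finset B => C.image (e.toEquiv.permCongr σ)) '' _ =
    _ '' ((fun C : Finset A => C.image σ) '' _)
  simp [Set.image_image, Finset.image_image, Function.comp_def]

end transfer

theorem ConfIso.multEquiv {p q : ℕ} (hp : p.Prime) (hq : q.Prime) (hqp : q < p)
    {S₁ S₂ : Finset (ZMod (p * q))} (hS₂ : UniqueDiffs S₂) (hne : S₂.Nonempty)
    (h : ConfIso (p * q) S₁ S₂) : MultEquiv (p * q) S₁ S₂ := by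
  have := Fact.mk hp
  have := Fact.mk hq
  obtain ⟨σ, hσ⟩ := h
  let e := ZMod.chineseRemainder ((Nat.coprime_primes hp hq).2 hqp.ne')
  obtain ⟨a, b, ha, hb, w, hw⟩ := exists_affine_of_smul_translates_eq hqp
    (hS₂.image e.toAddEquiv) (hne.image _)
    (permCongr_smul_translates_image (S := S₁) (T := S₂) e.toAddEquiv hσ)
  obtain ⟨u, hu⟩ : IsUnit (e.symm (a, b)) :=
    (Prod.isUnit_iff.2 ⟨ha.isUnit, hb.isUnit⟩).map e.symm
  have key : ∀ x, x ∈ S₁ ↔ u * x + e.symm w ∈ S₂ := fun x => by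
    have h1 := hw (e x)
    have h2 : (a * (e x).1, b * (e x).2) + w = e (u * x + e.symm w) := by
      simp [hu, Prod.mul_def]
    rw [h2] at h1
    exact ((e.injective.mem_finset_image).symm.trans h1).trans e.injective.mem_finset_image
  refine ⟨u⁻¹, -(↑u⁻¹ * e.symm w), ?_⟩
  ext x
  rw [key, Finset.mem_image]
  constructor
  · exact fun hx => ⟨_, hx, by simp [mul_add]⟩
  · rintro ⟨y, hy, rfl⟩
    simpa [mul_add] using hy

theorem MultEquiv.confIso {v : ℕ} {S₁ S₂ : Finset (ZMod v)} (h : MultEquiv v S₁ S₂) :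
    ConfIso v S₁ S₂ := by
  obtain ⟨a, b, rfl⟩ := h
  have key : ∀ i, ((S₂.image fun x => (a : ZMod v) * x + b).image (· + i)).image
      (Units.mulLeft a⁻¹) = S₂.image (· + ↑a⁻¹ * (b + i)) := fun i => by
    simp [Finset.image_image, Function.comp_def, mul_add, add_assoc]
  refine ⟨Units.mulLeft a⁻¹, ?_⟩
  ext C
  constructor
  · rintro ⟨_, ⟨i, rfl⟩, rfl⟩
    exact ⟨_, key i⟩
  · rintro ⟨i, rfl⟩
    exact ⟨_, ⟨a * i - b, rfl⟩, (key _).trans (by simp)⟩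

/-- Theorem B, case `v = pq`: for `v` a product of two distinct primes,
two balanced cyclic configurations of type (v_k) are isomorphic iff they are
multiplier equivalent. -/
theorem confIso_iff_multEquiv_of_eq_mul_primes
    (p q : ℕ) (hp : p.Prime) (hq : q.Prime) (hpq : p ≠ q)
    (v : ℕ) (hv : v = p * q) (k : ℕ) (hk : 3 ≤ k)
    (S₁ S₂ : Finset (ZMod v))
    (hcard₁ : S₁.card = k) (hdiff₁ : (S₁ - S₁).card = k ^ 2 - k + 1)
    (hcard₂ : S₂.card = k) (hdiff₂ : (S₂ - S₂).card = k ^ 2 - k + 1) :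
    ConfIso v S₁ S₂ ↔ MultEquiv v S₁ S₂ := by
  have hne : S₂.Nonempty := Finset.card_pos.1 (by omega)
  have hS₂ : UniqueDiffs S₂ := uniqueDiffs_of_card_sub (by rw [hdiff₂, hcard₂])
  refine ⟨fun h => ?_, MultEquiv.confIso⟩
  rcases lt_or_gt_of_ne hpq with hlt | hlt
  · rw [mul_comm] at hv
    subst hv
    exact h.multEquiv hq hp hlt hS₂ hne
  · subst hv
    exact h.multEquiv hp hq hlt hS₂ hne
end
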